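/- Let (P_1,Q_1) and (P_2,Q_2) be distinct pairs of integers with P_1 > 0, P_2 > 0, |Q_1| = |Q_2| = 1, and (P_i,Q_i) not in {(1,1),(2,1)} for i = 1,2. Then the following are equivalent: (a) the set {U_n(P_1,Q_1) : n >= 0} ∩ {U_m(P_2,Q_2) : m >= 0} is infinite; (b) P_1^2 - 4*Q_1 = P_2^2 - 4*Q_2; (c) {(P_1,Q_1),(P_2,Q_2)} = {(1,-1),(3,1)}. -/

import Mathlib

/-- Lucas sequence of the first kind: `U 0 = 0`, `U 1 = 1`,
`U (n+2) = P * U (n+1) - Q * U n`. -/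
def lucasU (P Q : ℤ) : ℕ → ℤ
  | 0 => 0
  | 1 => 1
  | n + 2 => P * lucasU P Q (n + 1) - Q * lucasU P Q n

/-- Lucas sequence of the second kind: `V 0 = 2`, `V 1 = P`,
`V (n+2) = P * V (n+1) - Q * V n`. -/
def lucasV (P Q : ℤ) : ℕ → ℤ
  | 0 => 2
  | 1 => P
  | n + 2 => P * lucasV P Q (n + 1) - Q * lucasV P Q n

section

open Polynomial

lemma eval_hasseDeriv_eq_sum_range {R : Type*} [CommSemiring R] {p : R[X]} {n : ℕ}
    (hp : p.natDegree < n) (j : ℕ) (x : R) :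
    (hasseDeriv j p).eval x =
      ∑ i ∈ Finset.range n, (i.choose j : R) * p.coeff i * x ^ (i - j) := by
  conv_lhs => rw [p.as_sum_range' n hp]
  simp [eval_finsetSum, hasseDeriv_monomial]

lemma abs_eval_hasseDeriv_le {p : ℝ[X]} {n : ℕ} {H R x : ℝ} (hp : p.natDegree < n)
    (hH : ∀ i, |p.coeff i| ≤ H) (hR : 1 ≤ R) (hx : |x| ≤ R) (j : ℕ) :
    |(hasseDeriv j p).eval x| ≤ n * 2 ^ n * H * R ^ n := by
  have hH0 : 0 ≤ H := (abs_nonneg _).trans (hH 0)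
  rw [eval_hasseDeriv_eq_sum_range hp]
  calc _ ≤ ∑ i ∈ Finset.range n, |(i.choose j : ℝ) * p.coeff i * x ^ (i - j)| :=
        Finset.abs_sum_le_sum_abs _ _
    _ ≤ ∑ i ∈ Finset.range n, 2 ^ n * H * R ^ n := by
        refine Finset.sum_le_sum fun i hi => ?_
        have hi' : i ≤ n := (Finset.mem_range.1 hi).le
        rw [abs_mul, abs_mul, abs_pow, Nat.abs_cast]
        have h1 : (i.choose j : ℝ) ≤ 2 ^ n := by
          exact_mod_cast (Nat.choose_le_two_pow i j).trans (Nat.pow_le_pow_right two_pos hi')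
        have h2 : |x| ^ (i - j) ≤ R ^ n :=
          (pow_le_pow_left₀ (abs_nonneg _) hx _).trans
            (pow_le_pow_right₀ hR ((Nat.sub_le _ _).trans hi'))
        gcongr
        exact hH i
    _ = _ := by simp; ring

lemma abs_eval_hasseDeriv_le_of_vanish {p : ℝ[X]} {n k : ℕ} {H R x y : ℝ}
    (hp : p.natDegree < n) (hH : ∀ i, |p.coeff i| ≤ H) (hR : 1 ≤ R) (hx : |x| ≤ R)
    (hv : ∀ i < k, (hasseDeriv i p).eval x = 0) (hxy : |y - x| ≤ 1) (j : ℕ) :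
    |(hasseDeriv j p).eval y| ≤ n * 2 ^ n * (n * 2 ^ n * H * R ^ n) * |y - x| ^ (k - j) := by
  have hq : (taylor x p).natDegree < n := by rwa [natDegree_taylor]
  have key : (hasseDeriv j p).eval y = (hasseDeriv j (taylor x p)).eval (y - x) := by
    rw [← taylor_coeff, ← taylor_coeff, taylor_taylor, sub_add_cancel]
  rw [key, eval_hasseDeriv_eq_sum_range hq]
  have hH0 : 0 ≤ H := (abs_nonneg _).trans (hH 0)
  calc _ ≤ ∑ i ∈ Finset.range n,
          |(i.choose j : ℝ) * (taylor x p).coeff i * (y - x) ^ (i - j)| :=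
        Finset.abs_sum_le_sum_abs _ _
    _ ≤ ∑ i ∈ Finset.range n, 2 ^ n * (n * 2 ^ n * H * R ^ n) * |y - x| ^ (k - j) := by
        refine Finset.sum_le_sum fun i hi => ?_
        have hi' : i ≤ n := (Finset.mem_range.1 hi).le
        rw [abs_mul, abs_mul, abs_pow, Nat.abs_cast, taylor_coeff]
        rcases lt_or_ge i k with h | h
        · rw [hv i h]
          simp only [abs_zero, mul_zero, zero_mul]
          positivity
        · have h1 : (i.choose j : ℝ) ≤ 2 ^ n := by
            exact_mod_cast (Nat.choose_le_two_pow i j).trans (Nat.pow_le_pow_right two_pos hi')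
          have h2 : |y - x| ^ (i - j) ≤ |y - x| ^ (k - j) :=
            pow_le_pow_of_le_one (abs_nonneg _) hxy (by omega)
          have h3 := abs_eval_hasseDeriv_le hp hH hR hx i
          gcongr
    _ = _ := by simp; ring

lemma X_sub_C_pow_dvd_iff_hasseDeriv {R : Type*} [CommRing R] {p : R[X]} {t : R} {n : ℕ} :
    (X - C t) ^ n ∣ p ↔ ∀ i < n, (hasseDeriv i p).eval t = 0 := by
  rw [X_sub_C_pow_dvd_iff, X_pow_dvd_iff]
  simp only [← taylor_coeff, taylor_apply]

lemma X_sub_C_pow_dvd_wronskian {R : Type*} [CommRing R] {p q : R[X]} {t : R} {n : ℕ}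
    (h : (X - C t) ^ (n + 1) ∣ p) : (X - C t) ^ n ∣ wronskian p q := by
  have h1 := pow_sub_one_dvd_derivative_of_pow_dvd h
  rw [Nat.add_sub_cancel] at h1
  exact dvd_sub (((pow_dvd_pow _ n.le_succ).trans h).mul_right _) (h1.mul_right _)

lemma den_pow_le_abs_leadingCoeff {p : ℤ[X]} (hp : p ≠ 0) {t : ℚ} {n : ℕ}
    (h : (X - C t) ^ n ∣ p.map (Int.castRingHom ℚ)) : (t.den : ℤ) ^ n ≤ |p.leadingCoeff| := by
  set l : ℤ[X] := C (t.den : ℤ) * X - C t.num with hl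
  have hden : (t.den : ℚ) ≠ 0 := by exact_mod_cast t.den_ne_zero
  have hprim : l.IsPrimitive := by
    intro r hr
    rw [C_dvd_iff_dvd_coeff] at hr
    have h0 := hr 0
    have h1 := hr 1
    simp only [hl, coeff_sub, coeff_C_mul, coeff_X_zero, coeff_X_one, coeff_C_zero, mul_zero,
      zero_sub, dvd_neg, mul_one, coeff_C_succ, sub_zero] at h0 h1
    have hc : IsCoprime t.num (t.den : ℤ) := Rat.isCoprime_num_den t
    exact hc.isUnit_of_dvd' h0 h1
  have hmap : l.map (Int.castRingHom ℚ) = C (t.den : ℚ) * (X - C t) := by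
    rw [hl, mul_sub, ← C_mul, mul_comm (t.den : ℚ) t, Rat.mul_den_eq_num]
    simp
  have hpow : (l ^ n).IsPrimitive := by
    induction n with
    | zero => simp
    | succ n ih => exact pow_succ l n ▸ (ih ((pow_dvd_pow _ n.le_succ).trans h)).mul hprim
  have hdvd : l ^ n ∣ p := by
    rw [IsPrimitive.Int.dvd_iff_map_cast_dvd_map_cast _ _ hpow, Polynomial.map_pow, hmap,
      mul_pow, ← C_pow]
    exact (IsUnit.mul_left_dvd (isUnit_C.2 (hden.isUnit.pow n))).2 h
  obtain ⟨g, hg⟩ := hdvd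
  have hlead : l.leadingCoeff = t.den := by
    have : l = C (t.den : ℤ) * X + C (-t.num) := by simp [hl, sub_eq_add_neg]
    rw [this, leadingCoeff_linear (by exact_mod_cast t.den_ne_zero)]
  have : (t.den : ℤ) ^ n ∣ p.leadingCoeff := by
    rw [hg, leadingCoeff_mul, leadingCoeff_pow, hlead]
    exact dvd_mul_right _ _
  exact Int.le_of_dvd (abs_pos.2 (leadingCoeff_ne_zero.2 hp)) ((dvd_abs _ _).2 this)

lemma exists_eq_C_mul_of_wronskian_eq_zero {F : Type*} [Field F] [CharZero F] {p q : F[X]}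
    (h : wronskian p q = 0) (hq : q ≠ 0) : ∃ c : F, p = C c * q := by
  classical
  have hc := isCoprime_div_gcd_div_gcd (p := p) (q := q) hq
  set g := gcd p q with hg
  have hg0 : g ≠ 0 := fun h0 => hq ((gcd_eq_zero_iff p q).1 h0).2
  obtain ⟨a, ha⟩ : g ∣ p := gcd_dvd_left p q
  obtain ⟨b, hb⟩ : g ∣ q := gcd_dvd_right p q
  rw [ha, hb, mul_div_cancel_left₀ _ hg0,
    mul_div_cancel_left₀ _ hg0] at hc
  have hw : wronskian a b = 0 := by
    have : g ^ 2 * wronskian a b = 0 := by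
      rw [← h, ha, hb]
      simp only [wronskian, derivative_mul]
      ring
    exact (mul_eq_zero.1 this).resolve_left (pow_ne_zero _ hg0)
  obtain ⟨ha', hb'⟩ := hc.wronskian_eq_zero_iff.1 hw
  rw [eq_C_of_derivative_eq_zero ha'] at ha
  rw [eq_C_of_derivative_eq_zero hb'] at hb
  have hb0 : b.coeff 0 ≠ 0 := by
    intro h0
    rw [h0, C_0, mul_zero] at hb
    exact hq hb
  refine ⟨a.coeff 0 / b.coeff 0, ?_⟩
  rw [ha, hb, mul_left_comm, ← C_mul, div_mul_cancel₀ _ hb0]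

lemma pow_minpoly_dvd {F E : Type*} [Field F] [CharZero F] [Field E] [Algebra F E] {τ : E}
    (hτ : IsIntegral F τ) (k : ℕ) {p : F[X]}
    (h : (X - C τ) ^ k ∣ p.map (algebraMap F E)) : minpoly F τ ^ k ∣ p := by
  induction k generalizing p with
  | zero => simp
  | succ k ih =>
    have hroot : aeval τ p = 0 := by
      rw [← eval_map_algebraMap, ← IsRoot.def, ← dvd_iff_isRoot]
      exact (dvd_pow_self _ k.succ_ne_zero).trans h
    obtain ⟨g, rfl⟩ := minpoly.dvd F τ hroot
    obtain ⟨u, hu⟩ : (X - C τ) ∣ (minpoly F τ).map (algebraMap F E) := by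
      rw [dvd_iff_isRoot, IsRoot.def, eval_map_algebraMap, minpoly.aeval]
    have hder := (minpoly.irreducible hτ).separable.aeval_derivative_ne_zero (minpoly.aeval F τ)
    have hu0 : u.eval τ ≠ 0 := by
      rw [← eval_map_algebraMap, ← derivative_map, hu] at hder
      simpa [derivative_mul] using hder
    have hcop : IsCoprime ((X - C τ) ^ k) u :=
      IsCoprime.pow_left (((irreducible_X_sub_C τ).coprime_iff_not_dvd).2
        fun hd => hu0 (dvd_iff_isRoot.1 hd))
    rw [Polynomial.map_mul, hu, pow_succ', mul_assoc] at h
    rw [pow_succ']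
    exact mul_dvd_mul_left _
      (ih (hcop.dvd_of_dvd_mul_left ((mul_dvd_mul_iff_left (X_sub_C_ne_zero τ)).1 h)))

lemma hasseDeriv_map {R S : Type*} [Semiring R] [Semiring S] (f : R →+* S) (p : R[X]) (j : ℕ) :
    hasseDeriv j (p.map f) = (hasseDeriv j p).map f := by
  ext i
  simp [hasseDeriv_coeff]

/-- If `A + τ B` vanishes to high order at `τ`, then `A` and `B` are not proportional. -/
lemma wronskian_ne_zero_of_vanish {τ : ℝ} (hτ : IsIntegral ℚ τ) {d k : ℕ}
    (hd : d ≤ (minpoly ℚ τ).natDegree) (hd2 : 1 < d) {A B : ℚ[X]} (hAB : A ≠ 0 ∨ B ≠ 0)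
    (hA : A.natDegree < d * k) (hB : B.natDegree < d * k)
    (h : (X - C τ) ^ k ∣ A.map (algebraMap ℚ ℝ) + C τ * B.map (algebraMap ℚ ℝ)) :
    wronskian A B ≠ 0 := by
  have key : ∀ p : ℚ[X], p.natDegree < d * k → (X - C τ) ^ k ∣ p.map (algebraMap ℚ ℝ) → p = 0 := by
    intro p hp hdvd
    by_contra hp0
    have := natDegree_le_of_dvd (pow_minpoly_dvd hτ k hdvd) hp0
    rw [natDegree_pow, mul_comm] at this
    exact absurd (hp.trans_le (Nat.mul_le_mul_right k hd)) this.not_gt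
  intro hw
  by_cases hB0 : B = 0
  · subst hB0
    exact hAB.elim (fun h0 => h0 (key A hA (by simpa using h))) (fun h0 => h0 rfl)
  · obtain ⟨c, rfl⟩ := exists_eq_C_mul_of_wronskian_eq_zero hw hB0
    have hne : (c : ℝ) + τ ≠ 0 := by
      intro h0
      have hτ' : τ = algebraMap ℚ ℝ (-c) := by
        push_cast [eq_ratCast]
        linarith
      rw [hτ', minpoly.eq_X_sub_C, natDegree_X_sub_C] at hd
      omega
    refine hB0 (key B hB ?_)
    have heq : (C c * B).map (algebraMap ℚ ℝ) + C τ * B.map (algebraMap ℚ ℝ)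
        = C ((c : ℝ) + τ) * B.map (algebraMap ℚ ℝ) := by
      simp [add_mul]
    rw [heq] at h
    exact (IsUnit.dvd_mul_left (isUnit_C.2 hne.isUnit)).1 h

/-- The powers of a root of a monic integer polynomial have coordinates of at most exponential
growth in the power basis. -/
lemma exists_coords_pow {d : ℕ} {τ : ℝ} {a : Fin d → ℤ}
    (hτ : τ ^ d = ∑ l, (a l : ℝ) * τ ^ (l : ℕ)) :
    ∃ K : ℕ, 1 ≤ K ∧ ∃ c : ℕ → Fin d → ℤ,
      (∀ n, τ ^ n = ∑ l, (c n l : ℝ) * τ ^ (l : ℕ)) ∧ ∀ n l, |c n l| ≤ (K : ℤ) ^ n := by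
  rcases d with _ | d
  · exact ⟨1, le_rfl, fun _ => Fin.elim0, by simp at hτ, fun _ l => l.elim0⟩
  let K : ℕ := 1 + ∑ l, (a l).natAbs
  have haK : ∀ l, 1 + |a l| ≤ (K : ℤ) := by
    intro l
    have := Finset.single_le_sum (f := fun l => (a l).natAbs) (fun _ _ => Nat.zero_le _)
      (Finset.mem_univ l)
    simp only [K]
    push_cast at this ⊢
    zify at this
    linarith
  let c : ℕ → Fin (d + 1) → ℤ := fun n => Nat.rec (Fin.cons 1 0)
    (fun _ v => (Fin.cons 0 (Fin.init v) : Fin (d + 1) → ℤ) + v (Fin.last d) • a) n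
  have hc : ∀ n, c (n + 1) =
      (Fin.cons 0 (Fin.init (c n)) : Fin (d + 1) → ℤ) + c n (Fin.last d) • a := fun _ => rfl
  refine ⟨K, by simp [K], c, fun n => ?_, fun n => ?_⟩
  · induction n with
    | zero => simp [c, Fin.sum_univ_succ]
    | succ n ih =>
      rw [pow_succ, ih, hc, Fin.sum_univ_castSucc, add_mul, mul_assoc _ (τ ^ _), ← pow_succ,
        Fin.val_last, hτ]
      simp only [Pi.add_apply, Pi.smul_apply, smul_eq_mul, Int.cast_add, Int.cast_mul, add_mul,
        Finset.sum_add_distrib, Finset.mul_sum, Finset.sum_mul]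
      rw [Fin.sum_univ_succ (fun i => ((Fin.cons 0 (Fin.init (c n)) : Fin (d + 1) → ℤ) i : ℝ) * _)]
      simp [Fin.init, pow_succ, mul_assoc]
  · induction n with
    | zero => intro l; refine Fin.cases ?_ ?_ l <;> simp [c]
    | succ n ih =>
      intro l
      have h1 : |(Fin.cons 0 (Fin.init (c n)) : Fin (d + 1) → ℤ) l| ≤ (K : ℤ) ^ n := by
        refine Fin.cases ?_ (fun i => ?_) l
        · simp
        · simpa [Fin.init] using ih i.castSucc
      rw [hc, Pi.add_apply, Pi.smul_apply, smul_eq_mul]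
      calc _ ≤ (K : ℤ) ^ n + (K : ℤ) ^ n * |a l| := by
            refine (abs_add_le _ _).trans (add_le_add h1 ?_)
            rw [abs_mul]
            gcongr
            exact ih _
        _ = (K : ℤ) ^ n * (1 + |a l|) := by ring
        _ ≤ _ := by
            rw [pow_succ]
            gcongr
            exact haK l

attribute [local instance] Matrix.seminormedAddCommGroup in
/-- Thue's auxiliary polynomial. -/
lemma exists_auxiliary_polynomial {τ : ℝ} {a : Fin 4 → ℤ}
    (hτ : τ ^ 4 = ∑ l, (a l : ℝ) * τ ^ (l : ℕ)) :
    ∃ K : ℕ, 1 ≤ K ∧ ∀ h : ℕ, 1 ≤ h → ∃ A B : ℤ[X], (A ≠ 0 ∨ B ≠ 0) ∧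
      A.natDegree < 25 * h ∧ B.natDegree < 25 * h ∧
      (∀ i, |A.coeff i| ≤ (K : ℤ) ^ h) ∧ (∀ i, |B.coeff i| ≤ (K : ℤ) ^ h) ∧
      ∀ j < 10 * h, (hasseDeriv j (A.map (Int.castRingHom ℝ))).eval τ +
        τ * (hasseDeriv j (B.map (Int.castRingHom ℝ))).eval τ = 0 := by
  obtain ⟨K, hK, c, hc, hcb⟩ := exists_coords_pow hτ
  refine ⟨(100 * (2 * K) ^ 25) ^ 4, Nat.one_le_pow _ _ (by positivity), fun h hh => ?_⟩
  let M : Matrix (Fin (10 * h) × Fin 4) (Fin 2 × Fin (25 * h)) ℤ := fun r s =>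
    ((s.2 : ℕ).choose r.1 : ℤ) * c (s.2 - r.1 + s.1) r.2
  have hM : ∀ r s, |M r s| ≤ (2 * (K : ℤ)) ^ (25 * h) := by
    intro r s
    simp only [M]
    rw [abs_mul, Nat.abs_cast, mul_pow]
    have h1 : (((s.2 : ℕ).choose r.1 : ℕ) : ℤ) ≤ 2 ^ (25 * h) := by
      exact_mod_cast (Nat.choose_le_two_pow _ _).trans (Nat.pow_le_pow_right two_pos s.2.2.le)
    have h2 : |c (s.2 - r.1 + s.1) r.2| ≤ (K : ℤ) ^ (25 * h) := by
      refine (hcb _ _).trans (pow_le_pow_right₀ (by exact_mod_cast hK) ?_)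
      have := s.1.2
      have := s.2.2
      omega
    gcongr
  obtain ⟨t, ht0, htM, htb⟩ := Int.Matrix.exists_ne_zero_int_vec_norm_le M
    (by simp; omega) (by simp; omega)
  have hnorm : ‖t‖ ≤ ((100 * (2 * (K : ℝ)) ^ 25) ^ 4) ^ h := by
    refine htb.trans ?_
    have hexp : ((Fintype.card (Fin (10 * h) × Fin 4) : ℕ) : ℝ) /
        ((Fintype.card (Fin 2 × Fin (25 * h)) : ℕ) - (Fintype.card (Fin (10 * h) × Fin 4) : ℕ))
        = (4 : ℕ) := by
      have : (h : ℝ) ≠ 0 := by positivity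
      simp only [Fintype.card_prod, Fintype.card_fin]
      push_cast
      rw [div_eq_iff (by ring_nf; simpa using this)]
      ring
    rw [hexp, Real.rpow_natCast, ← pow_mul, mul_comm 4 h, pow_mul]
    refine pow_le_pow_left₀ (by positivity) ?_ 4
    have hMn : max 1 ‖M‖ ≤ (2 * (K : ℝ)) ^ (25 * h) := by
      have h1K : (1 : ℝ) ≤ K := by exact_mod_cast hK
      refine max_le (one_le_pow₀ (by linarith)) ((Matrix.norm_le_iff (by positivity)).2 ?_)
      intro r s
      rw [Int.norm_eq_abs]
      exact_mod_cast hM r s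
    have h2 : ((Fintype.card (Fin 2 × Fin (25 * h)) : ℕ) : ℝ) ≤ 100 ^ h := by
      simp only [Fintype.card_prod, Fintype.card_fin]
      have : h < 2 ^ h := Nat.lt_two_pow_self
      have h3 : 2 * (25 * h) ≤ 100 ^ h := by
        calc 2 * (25 * h) ≤ 50 ^ h * 2 ^ h := by
              have : 50 ^ 1 ≤ 50 ^ h := Nat.pow_le_pow_right (by norm_num) hh
              nlinarith
          _ = 100 ^ h := by rw [← mul_pow]; norm_num
      exact_mod_cast h3
    calc _ ≤ (100 : ℝ) ^ h * (2 * (K : ℝ)) ^ (25 * h) := by gcongr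
      _ = _ := by rw [mul_pow _ _ h, ← pow_mul]
  have htb' : ∀ b i, |t (b, i)| ≤ (((100 * (2 * K) ^ 25) ^ 4 : ℕ) : ℤ) ^ h := by
    intro b i
    have := (norm_le_pi_norm t (b, i)).trans hnorm
    rw [Int.norm_eq_abs] at this
    exact_mod_cast this
  let A : Fin 2 → ℤ[X] := fun b => ofFn (25 * h) fun i => t (b, i)
  have hAd : ∀ b, (A b).natDegree < 25 * h := fun b => ofFn_natDegree_lt (by omega) _
  have hAc : ∀ b (i : Fin (25 * h)), (A b).coeff i = t (b, i) := fun b i =>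
    ofFn_coeff_eq_val_of_lt _ i.2
  have hAb : ∀ b i, |(A b).coeff i| ≤ (((100 * (2 * K) ^ 25) ^ 4 : ℕ) : ℤ) ^ h := by
    intro b i
    rcases lt_or_ge i (25 * h) with hi | hi
    · simpa [hAc b ⟨i, hi⟩] using htb' b ⟨i, hi⟩
    · rw [ofFn_coeff_eq_zero_of_ge _ hi, abs_zero]
      positivity
  refine ⟨A 0, A 1, ?_, hAd 0, hAd 1, hAb 0, hAb 1, fun j hj => ?_⟩
  · by_contra! hA
    refine ht0 (funext fun ⟨b, i⟩ => ?_)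
    rw [← hAc]
    fin_cases b
    · simp [hA.1]
    · simp [hA.2]
  · have hev : ∀ b : Fin 2, τ ^ (b : ℕ) *
        (hasseDeriv j ((A b).map (Int.castRingHom ℝ))).eval τ =
        ∑ l : Fin 4, (∑ i, (M (⟨j, hj⟩, l) (b, i) * t (b, i) : ℤ)) * τ ^ (l : ℕ) := by
      intro b
      rw [eval_hasseDeriv_eq_sum_range (n := 25 * h) (natDegree_map_le.trans_lt (hAd b)),
        Finset.sum_range, Finset.mul_sum]
      simp only [Int.cast_sum, Finset.sum_mul]
      rw [Finset.sum_comm]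
      refine Finset.sum_congr rfl fun i _ => ?_
      rw [coeff_map, hAc]
      calc _ = ((i : ℕ).choose j : ℝ) * (t (b, i) : ℝ) * τ ^ ((i : ℕ) - j + b) := by
            simp only [eq_intCast, pow_add]; ring
        _ = _ := by
          rw [hc, Finset.mul_sum]
          refine Finset.sum_congr rfl fun l _ => ?_
          simp only [M]
          push_cast
          ring
    have h0 := hev 0
    have h1 := hev 1
    simp only [Fin.val_zero, pow_zero, one_mul, Fin.val_one, pow_one] at h0 h1
    rw [h0, h1, ← Finset.sum_add_distrib]
    refine Finset.sum_eq_zero fun l _ => ?_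
    rw [← add_mul, ← Int.cast_add]
    have := congrFun htM (⟨j, hj⟩, l)
    simp only [Matrix.mulVec, dotProduct, Fintype.sum_prod_type, Fin.sum_univ_two,
      Pi.zero_apply] at this
    rw [this]
    simp

lemma abs_leadingCoeff_wronskian_le {A B : ℤ[X]} {n : ℕ} {H : ℤ} (hA : A.natDegree < n)
    (hB : B.natDegree < n) (hAH : ∀ i, |A.coeff i| ≤ H) (hBH : ∀ i, |B.coeff i| ≤ H)
    (hW : wronskian A B ≠ 0) : |(wronskian A B).leadingCoeff| ≤ 4 * n ^ 2 * H ^ 2 := by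
  have hH0 : 0 ≤ H := (abs_nonneg _).trans (hAH 0)
  have hder : ∀ p : ℤ[X], p.natDegree < n → (∀ i, |p.coeff i| ≤ H) →
      ∀ i, |(derivative p).coeff i| ≤ n * H := by
    intro p hp hpH i
    rw [coeff_derivative, abs_mul, mul_comm]
    rcases lt_or_ge p.natDegree (i + 1) with hi | hi
    · rw [coeff_eq_zero_of_natDegree_lt hi, abs_zero, mul_zero]
      positivity
    · refine mul_le_mul ?_ (hpH _) (abs_nonneg _) (by positivity)
      rw [abs_of_nonneg (by positivity)]
      exact_mod_cast hi.trans hp.le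
  have hmul : ∀ p q : ℤ[X], (∀ i, |p.coeff i| ≤ H) → (∀ i, |q.coeff i| ≤ n * H) →
      ∀ m < 2 * n, |(p * q).coeff m| ≤ 2 * n * (H * (n * H)) := by
    intro p q hp hq m hm
    rw [coeff_mul, Finset.Nat.sum_antidiagonal_eq_sum_range_succ_mk]
    calc _ ≤ ∑ k ∈ Finset.range (m + 1), |p.coeff k * q.coeff (m - k)| :=
          Finset.abs_sum_le_sum_abs _ _
      _ ≤ ∑ k ∈ Finset.range (m + 1), H * (n * H) := by
          refine Finset.sum_le_sum fun k _ => ?_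
          rw [abs_mul]
          exact mul_le_mul (hp _) (hq _) (abs_nonneg _) hH0
      _ = (m + 1 : ℕ) * (H * (n * H)) := by simp
      _ ≤ _ := by
          gcongr
          exact_mod_cast hm
  have hdeg : (wronskian A B).natDegree < 2 * n := by
    have := natDegree_wronskian_lt_add hW
    omega
  rw [leadingCoeff, wronskian, coeff_sub, ← wronskian]
  have h1 := hmul A (derivative B) hAH (hder B hB hBH) _ hdeg
  have h2 := hmul B (derivative A) hBH (hder A hA hAH) _ hdeg
  rw [mul_comm B] at h2
  refine (abs_sub _ _).trans ((add_le_add h1 h2).trans (le_of_eq ?_))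
  ring

lemma den_pow_le_of_vanish {A B : ℤ[X]} (hW : wronskian A B ≠ 0) {t u : ℚ} {n : ℕ}
    (h : ∀ j ≤ n, (hasseDeriv j (A.map (Int.castRingHom ℚ))).eval t +
      u * (hasseDeriv j (B.map (Int.castRingHom ℚ))).eval t = 0) :
    (t.den : ℤ) ^ n ≤ |(wronskian A B).leadingCoeff| := by
  refine den_pow_le_abs_leadingCoeff hW ?_
  set A' := A.map (Int.castRingHom ℚ)
  set B' := B.map (Int.castRingHom ℚ)
  have h1 : (X - C t) ^ (n + 1) ∣ A' + u • B' := by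
    refine X_sub_C_pow_dvd_iff_hasseDeriv.2 fun j hj => ?_
    simpa using h j (by omega)
  convert! X_sub_C_pow_dvd_wronskian (q := B') h1 using 1
  simp [wronskian, derivative_map, A', B', smul_eq_C_mul]
  ring

lemma one_le_den_pow_mul {A B : ℤ[X]} {m : ℕ} (hA : A.natDegree ≤ m) (hB : B.natDegree ≤ m)
    {t u : ℚ}
    (h : (A.map (Int.castRingHom ℝ)).eval (t : ℝ) +
      u * (B.map (Int.castRingHom ℝ)).eval (t : ℝ) ≠ 0) :
    1 ≤ (t.den : ℝ) ^ m * u.den * |(A.map (Int.castRingHom ℝ)).eval (t : ℝ) +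
      u * (B.map (Int.castRingHom ℝ)).eval (t : ℝ)| := by
  set f : ℤ[X] := C (u.den : ℤ) * A + C u.num * B with hf
  have hu0 : (u.den : ℝ) ≠ 0 := by exact_mod_cast u.den_ne_zero
  have ht : ((t.num : ℤ) : ℝ) / ((t.den : ℤ) : ℝ) = t := by
    exact_mod_cast congrArg (Rat.cast : ℚ → ℝ) t.num_div_den
  have hu : ((u.num : ℤ) : ℝ) = u.den * u := by
    exact_mod_cast congrArg (Rat.cast : ℚ → ℝ) (Rat.den_mul_eq_num u).symm
  have hev : eval (((t.num : ℤ) : ℝ) / ((t.den : ℤ) : ℝ)) (f.map (algebraMap ℤ ℝ)) =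
      u.den * ((A.map (Int.castRingHom ℝ)).eval (t : ℝ) +
      u * (B.map (Int.castRingHom ℝ)).eval (t : ℝ)) := by
    rw [ht, hf]
    simp only [Polynomial.map_add, Polynomial.map_mul, map_C, eval_add, eval_mul, eval_C,
      algebraMap_int_eq]
    rw [eq_intCast, eq_intCast, hu]
    push_cast
    ring
  have hfm : f.natDegree ≤ m :=
    natDegree_add_le_of_degree_le ((natDegree_C_mul_le _ _).trans hA)
      ((natDegree_C_mul_le _ _).trans hB)
  have key := one_le_pow_mul_abs_eval_div (K := ℝ) (f := f) (a := t.num) (b := t.den)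
    (by exact_mod_cast t.den_pos) (by rw [hev]; exact mul_ne_zero hu0 h)
  rw [hev, abs_mul, Nat.abs_cast] at key
  calc (1 : ℝ) ≤ _ := key
    _ ≤ (t.den : ℝ) ^ m * (u.den * _) := by
      push_cast
      gcongr
      exact_mod_cast t.den_pos
    _ = _ := by ring

lemma finite_setOf_den_lt (x r : ℝ) (N : ℕ) : {t : ℚ | t.den < N ∧ |x - t| ≤ r}.Finite := by
  obtain ⟨M, hM⟩ := exists_nat_ge (|x| + r)
  refine Set.Finite.of_finite_image (f := fun t : ℚ => (t.num, t.den)) (Set.Finite.subset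
    ((Set.finite_Icc (-(M * N : ℤ)) (M * N)).prod (Set.finite_Iio N)) ?_) ?_
  · rintro _ ⟨t, ⟨htN, ht⟩, rfl⟩
    refine ⟨abs_le.1 ?_, htN⟩
    have h1 : |(t : ℝ)| ≤ M := by
      have := abs_sub_abs_le_abs_sub (t : ℝ) x
      rw [abs_sub_comm] at this
      linarith
    have h2 : |t| ≤ M := by exact_mod_cast h1
    have h3 : (|t.num| : ℚ) = |t| * t.den := by
      rw [← Rat.mul_den_eq_num, abs_mul, Nat.abs_cast]
    have h4 : (|t.num| : ℚ) ≤ M * N := by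
      rw [h3]
      gcongr
    exact_mod_cast h4
  · intro s _ t _ hst
    simp only [Prod.mk.injEq] at hst
    exact Rat.ext hst.1 hst.2

lemma exists_den_pow_le_add_pow_le {τ : ℝ} {a : Fin 4 → ℤ}
    (hτ : τ ^ 4 = ∑ l, (a l : ℝ) * τ ^ (l : ℕ)) (hdeg : 3 ≤ (minpoly ℚ τ).natDegree) {c : ℕ}
    (hc : 1 ≤ c) :
    ∃ E : ℕ, 1 ≤ E ∧ ∀ t u : ℚ, |τ - t| ≤ c / (t.den : ℝ) ^ 4 → |τ - u| ≤ c / (u.den : ℝ) ^ 4 →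
      ∀ h : ℕ, 1 ≤ h → E < t.den → ∃ j ≤ h,
        1 ≤ (t.den : ℝ) ^ (25 * h - 1 - j) * u.den *
          (E ^ h * (1 / (t.den : ℝ) ^ (4 * (10 * h - j)) + 1 / (u.den : ℝ) ^ 4)) := by
  obtain ⟨K, hK, haux⟩ := exists_auxiliary_polynomial hτ
  obtain ⟨R, hR⟩ := exists_nat_ge (|τ| + c)
  have hcR : (1 : ℝ) ≤ c := by exact_mod_cast hc
  have hR1 : (1 : ℝ) ≤ R := by linarith [abs_nonneg τ]
  have hK1 : (1 : ℝ) ≤ K := by exact_mod_cast hK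
  have hint : IsIntegral ℚ τ := by
    by_contra h
    rw [minpoly.eq_zero h] at hdeg
    simp at hdeg
  obtain ⟨E, hE⟩ : ∃ E : ℕ, E = 2 ^ 101 * R ^ 26 * K ^ 2 * c ^ 10 := ⟨_, rfl⟩
  have hER : (E : ℝ) = 2 ^ 101 * R ^ 26 * K ^ 2 * c ^ 10 := by rw [hE]; push_cast; ring
  have hR26 : (1 : ℝ) ≤ R ^ 26 := one_le_pow₀ hR1
  have hK2 : (1 : ℝ) ≤ K ^ 2 := one_le_pow₀ hK1
  have hKK2 : (K : ℝ) ≤ K ^ 2 := le_self_pow₀ hK1 (by norm_num)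
  have hc10 : (1 : ℝ) ≤ c ^ 10 := one_le_pow₀ hcR
  have hcc10 : (c : ℝ) ≤ c ^ 10 := le_self_pow₀ hcR (by norm_num)
  have hcomp : (algebraMap ℚ ℝ).comp (Int.castRingHom ℚ) = Int.castRingHom ℝ :=
    Subsingleton.elim _ _
  have hE1 : 1 ≤ E := by
    have hR1' : 1 ≤ R := by exact_mod_cast hR1
    rw [hE]
    exact Nat.one_le_iff_ne_zero.2 (by positivity)
  refine ⟨E, hE1, fun t u ht hu h hh htE => ?_⟩
  obtain ⟨A, B, hAB, hAd, hBd, hAK, hBK, hv⟩ := haux h hh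
  set n := 25 * h with hn
  have htden : (1 : ℝ) ≤ t.den := by exact_mod_cast t.den_pos
  have huden : (1 : ℝ) ≤ u.den := by exact_mod_cast u.den_pos
  -- the Wronskian is nonzero
  have hWQ : wronskian (A.map (Int.castRingHom ℚ)) (B.map (Int.castRingHom ℚ)) ≠ 0 := by
    have hinj := Polynomial.map_injective (Int.castRingHom ℚ) Int.cast_injective
    refine wronskian_ne_zero_of_vanish (k := 10 * h) hint hdeg (by norm_num) ?_ ?_ ?_ ?_
    · rwa [Polynomial.map_ne_zero_iff Int.cast_injective,
        Polynomial.map_ne_zero_iff Int.cast_injective]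
    · exact natDegree_map_le.trans_lt (by omega)
    · exact natDegree_map_le.trans_lt (by omega)
    · rw [X_sub_C_pow_dvd_iff_hasseDeriv]
      intro j hj
      rw [← smul_eq_C_mul]
      simpa [Polynomial.map_map, hcomp] using hv j hj
  have hW : wronskian A B ≠ 0 := by
    intro h0
    apply hWQ
    have := congrArg (Polynomial.map (Int.castRingHom ℚ)) h0
    simpa [wronskian, derivative_map] using this
  have hn2 : (n : ℝ) ≤ 2 ^ n := by exact_mod_cast (Nat.lt_two_pow_self (n := n)).le
  -- some low order derivative does not vanish
  obtain ⟨j, hj, hne⟩ : ∃ j ≤ h, (hasseDeriv j (A.map (Int.castRingHom ℚ))).eval t +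
      u * (hasseDeriv j (B.map (Int.castRingHom ℚ))).eval t ≠ 0 := by
    by_contra! hall
    have h1 := den_pow_le_of_vanish hW hall
    have h2 := h1.trans (abs_leadingCoeff_wronskian_le hAd hBd hAK hBK hW)
    have h3 : 4 * (n : ℝ) ^ 2 * ((K : ℝ) ^ h) ^ 2 ≤ (E : ℝ) ^ h := by
      have h4 : (4 : ℝ) ≤ 4 ^ h := le_self_pow₀ (by norm_num) (by omega)
      calc 4 * (n : ℝ) ^ 2 * ((K : ℝ) ^ h) ^ 2 ≤ 4 ^ h * (2 ^ n) ^ 2 * ((K : ℝ) ^ h) ^ 2 := by gcongr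
        _ = (4 * 2 ^ 50 * (K : ℝ) ^ 2) ^ h := by
          rw [hn]; simp only [mul_pow, ← pow_mul]; ring
        _ ≤ _ := by
          refine pow_le_pow_left₀ (by positivity) ?_ h
          rw [hER]
          calc 4 * 2 ^ 50 * (K : ℝ) ^ 2 = 2 ^ 52 * 1 * K ^ 2 * 1 := by ring
            _ ≤ _ := by
              gcongr
              · norm_num
              · norm_num
    have h5 : (t.den : ℝ) ^ h ≤ (E : ℝ) ^ h := by
      refine le_trans ?_ h3
      exact_mod_cast h2
    have h6 : E ^ h < t.den ^ h := pow_lt_pow_left₀ htE (Nat.zero_le _) (by omega)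
    exact h6.not_ge (by exact_mod_cast h5)
  refine ⟨j, hj, ?_⟩
  have hcast : ∀ p : ℤ[X], (p.map (Int.castRingHom ℝ)).eval (t : ℝ) =
      (((p.map (Int.castRingHom ℚ)).eval t : ℚ) : ℝ) := by
    intro p
    have := hom_eval₂ p (Int.castRingHom ℚ) (Rat.castHom ℝ) t
    rw [eval_map, eval_map]
    rw [eq_comm, ← hcomp]
    exact this
  have hdeg' : ∀ p : ℤ[X], p.natDegree < n → (hasseDeriv j p).natDegree ≤ n - 1 - j := by
    intro p hp
    have := natDegree_hasseDeriv_le p j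
    omega
  have hlow := one_le_den_pow_mul (hdeg' A hAd) (hdeg' B hBd) (t := t) (u := u) (by
    rw [hcast, hcast, ← hasseDeriv_map, ← hasseDeriv_map]
    exact_mod_cast hne)
  refine hlow.trans ?_
  gcongr
  rw [← hasseDeriv_map, ← hasseDeriv_map]
  set A' := A.map (Int.castRingHom ℝ) with hA'
  set B' := B.map (Int.castRingHom ℝ) with hB'
  have hA'K : ∀ i, |A'.coeff i| ≤ (K : ℝ) ^ h := fun i => by
    rw [hA', coeff_map, eq_intCast]; exact_mod_cast hAK i
  have hB'K : ∀ i, |B'.coeff i| ≤ (K : ℝ) ^ h := fun i => by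
    rw [hB', coeff_map, eq_intCast]; exact_mod_cast hBK i
  have hA'd : A'.natDegree < n := natDegree_map_le.trans_lt hAd
  have hB'd : B'.natDegree < n := natDegree_map_le.trans_lt hBd
  have hc4 : (c : ℝ) / (t.den : ℝ) ^ 4 ≤ c :=
    div_le_self (by positivity) (one_le_pow₀ htden)
  have hτR : |τ| ≤ R := by linarith
  have htR : |(t : ℝ)| ≤ R := by
    have := abs_sub_abs_le_abs_sub (t : ℝ) τ
    rw [abs_sub_comm] at this
    linarith
  have htE' : (E : ℝ) < t.den := by exact_mod_cast htE
  have hcE : (c : ℝ) ≤ E := by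
    rw [hER]
    calc (c : ℝ) = 1 * 1 * 1 * c := by ring
      _ ≤ _ := by
        gcongr
        norm_num
  have ht1 : |(t : ℝ) - τ| ≤ 1 := by
    rw [abs_sub_comm]
    refine ht.trans (div_le_one_of_le₀ ?_ (by positivity))
    exact (hcE.trans htE'.le).trans (le_self_pow₀ htden (by norm_num))
  -- bounds for the two terms
  have hF := abs_eval_hasseDeriv_le_of_vanish (p := A' + τ • B') (n := n) (k := 10 * h)
    (H := K ^ h * (2 * R)) (R := R) (x := τ) (y := t)
    ((natDegree_add_le _ _).trans_lt (max_lt hA'd ((natDegree_smul_le _ _).trans_lt hB'd)))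
    (fun i => by
      rw [coeff_add, coeff_smul, smul_eq_mul]
      refine (abs_add_le _ _).trans ?_
      rw [abs_mul]
      calc |A'.coeff i| + |τ| * |B'.coeff i| ≤ K ^ h + R * K ^ h :=
            add_le_add (hA'K i) (mul_le_mul hτR (hB'K i) (abs_nonneg _) (by positivity))
        _ ≤ _ := by nlinarith [pow_pos (zero_lt_one.trans_le hK1) h])
    hR1 hτR (fun i hi => by simpa using hv i hi) ht1 j
  have hB := abs_eval_hasseDeriv_le hB'd hB'K hR1 htR j
  have hsplit : eval (t : ℝ) (hasseDeriv j A') + u * eval (t : ℝ) (hasseDeriv j B') =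
      eval (t : ℝ) (hasseDeriv j (A' + τ • B')) -
        (τ - u) * eval (t : ℝ) (hasseDeriv j B') := by
    simp
    ring
  have hpow : |(t : ℝ) - τ| ^ (10 * h - j) ≤ c ^ (10 * h) / (t.den : ℝ) ^ (4 * (10 * h - j)) := by
    rw [abs_sub_comm]
    calc _ ≤ (c / (t.den : ℝ) ^ 4) ^ (10 * h - j) := pow_le_pow_left₀ (abs_nonneg _) ht _
      _ = c ^ (10 * h - j) / (t.den : ℝ) ^ (4 * (10 * h - j)) := by rw [div_pow, ← pow_mul]
      _ ≤ _ := by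
        gcongr
        omega
  have hRh : 2 * (R : ℝ) ≤ (2 * R) ^ h := le_self_pow₀ (by linarith) (by omega)
  have hb1 : (n * 2 ^ n * (n * 2 ^ n * (K ^ h * (2 * R)) * R ^ n) * c ^ (10 * h) : ℝ) ≤ E ^ h := by
    calc _ ≤ (2 ^ n * 2 ^ n * (2 ^ n * 2 ^ n * (K ^ h * (2 * R) ^ h) * R ^ n) * c ^ (10 * h) : ℝ) := by
          gcongr
      _ = (2 ^ 101 * R ^ 26 * K ^ 1 * c ^ 10) ^ h := by
          rw [hn]; simp only [mul_pow, ← pow_mul]; ring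
      _ ≤ _ := by
          refine pow_le_pow_left₀ (by positivity) ?_ h
          rw [hER, pow_one]
          gcongr
  have hb2 : (n * 2 ^ n * K ^ h * R ^ n * c : ℝ) ≤ E ^ h := by
    refine le_trans ?_ hb1
    have hn1 : (1 : ℝ) ≤ n := by exact_mod_cast (by omega : 1 ≤ n)
    have h2n : (1 : ℝ) ≤ n * 2 ^ n := by
      have : (1 : ℝ) ≤ 2 ^ n := one_le_pow₀ (by norm_num)
      nlinarith
    have hc' : (c : ℝ) ≤ c ^ (10 * h) := le_self_pow₀ hcR (by omega)
    calc (n * 2 ^ n * K ^ h * R ^ n * c : ℝ) = n * 2 ^ n * (1 * (K ^ h * 1) * R ^ n) * c := by ring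
      _ ≤ _ := by
        gcongr
        linarith
  rw [hsplit]
  calc _ ≤ |eval (t : ℝ) (hasseDeriv j (A' + τ • B'))| + |τ - u| * |eval (t : ℝ) (hasseDeriv j B')| := by
        rw [← abs_mul]
        exact abs_sub _ _
    _ ≤ n * 2 ^ n * (n * 2 ^ n * (K ^ h * (2 * R)) * R ^ n) *
          (c ^ (10 * h) / (t.den : ℝ) ^ (4 * (10 * h - j))) +
        c / (u.den : ℝ) ^ 4 * (n * 2 ^ n * K ^ h * R ^ n) := by
        refine add_le_add (hF.trans ?_) (mul_le_mul hu hB (abs_nonneg _) (by positivity))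
        gcongr
    _ = (n * 2 ^ n * (n * 2 ^ n * (K ^ h * (2 * R)) * R ^ n) * c ^ (10 * h)) *
          (1 / (t.den : ℝ) ^ (4 * (10 * h - j))) +
        (n * 2 ^ n * K ^ h * R ^ n * c) * (1 / (u.den : ℝ) ^ 4) := by ring
    _ ≤ E ^ h * (1 / (t.den : ℝ) ^ (4 * (10 * h - j))) + E ^ h * (1 / (u.den : ℝ) ^ 4) := by
        gcongr
    _ = _ := by ring

/-- **Thue's theorem**, for exponent 4 and roots of monic integer quartics. -/
theorem finite_rat_approx_of_quartic {τ : ℝ} {a : Fin 4 → ℤ}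
    (hτ : τ ^ 4 = ∑ l, (a l : ℝ) * τ ^ (l : ℕ)) (hdeg : 3 ≤ (minpoly ℚ τ).natDegree) (r : ℝ) :
    {t : ℚ | |τ - t| ≤ r / (t.den : ℝ) ^ 4}.Finite := by
  obtain ⟨c, hc⟩ := exists_nat_ge (max r 1)
  have hc1 : 1 ≤ c := by exact_mod_cast (le_max_right r 1).trans hc
  have hsub : {t : ℚ | |τ - t| ≤ r / (t.den : ℝ) ^ 4} ⊆ {t : ℚ | |τ - t| ≤ c / (t.den : ℝ) ^ 4} := by
    intro t ht
    refine (Set.mem_ofPred_eq ▸ ht : |τ - t| ≤ _).trans ?_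
    gcongr
    exact (le_max_left r 1).trans hc
  refine Set.Finite.subset ?_ hsub
  by_contra hinf
  have hlarge : ∀ N : ℕ, ∃ t : ℚ, |τ - t| ≤ c / (t.den : ℝ) ^ 4 ∧ N ≤ t.den := by
    intro N
    by_contra! hall
    refine hinf ((finite_setOf_den_lt τ c N).subset fun t ht => ⟨hall t ht, le_trans ht ?_⟩)
    exact div_le_self (by positivity) (one_le_pow₀ (by exact_mod_cast t.den_pos))
  obtain ⟨E, hE1, hE⟩ := exists_den_pow_le_add_pow_le hτ hdeg hc1
  obtain ⟨t, ht, htN⟩ := hlarge (2 * E + 1)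
  obtain ⟨u, hu, huN⟩ := hlarge (t.den ^ 90)
  set p := t.den
  set q := u.den
  have hp2 : 1 < p := by omega
  have hq0 : q ≠ 0 := u.den_ne_zero
  set h := Nat.log p q / 10 with hh
  have hlog : 90 ≤ Nat.log p q := Nat.le_log_of_pow_le hp2 huN
  have hlow : p ^ (10 * h) ≤ q :=
    (Nat.pow_le_pow_right (by omega) (by omega)).trans (Nat.pow_log_le_self p hq0)
  have hup : q ≤ p ^ (10 * h + 10) :=
    (Nat.lt_pow_succ_log_self hp2 q).le.trans (Nat.pow_le_pow_right (by omega) (by omega))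
  obtain ⟨j, hj, key⟩ := hE t u ht hu h (by omega) (by omega)
  have hpR : (1 : ℝ) ≤ p := by exact_mod_cast hp2.le
  have hp0 : (0 : ℝ) < p := by linarith
  have hqR : (0 : ℝ) < q := by exact_mod_cast u.den_pos
  have hlowR : (p : ℝ) ^ (10 * h) ≤ q := by exact_mod_cast hlow
  have hupR : (q : ℝ) ≤ (p : ℝ) ^ (10 * h + 10) := by exact_mod_cast hup
  have h1 : (p : ℝ) ^ (25 * h - 1 - j) * q * (1 / (p : ℝ) ^ (4 * (10 * h - j))) ≤ 1 / p ^ h := by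
    rw [mul_one_div, div_le_div_iff₀ (by positivity) (by positivity), one_mul]
    calc _ ≤ (p : ℝ) ^ (25 * h - 1 - j) * p ^ (10 * h + 10) * p ^ h := by gcongr
      _ = (p : ℝ) ^ (25 * h - 1 - j + (10 * h + 10) + h) := by ring
      _ ≤ _ := pow_le_pow_right₀ hpR (by omega)
  have h2 : (p : ℝ) ^ (25 * h - 1 - j) * q * (1 / (q : ℝ) ^ 4) ≤ 1 / p ^ h := by
    rw [mul_one_div, div_le_div_iff₀ (by positivity) (by positivity), one_mul]
    calc (p : ℝ) ^ (25 * h - 1 - j) * q * p ^ h = (p : ℝ) ^ (25 * h - 1 - j + h) * q := by ring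
      _ ≤ ((p : ℝ) ^ (10 * h)) ^ 3 * q := by
        rw [← pow_mul]
        gcongr
        omega
      _ ≤ q ^ 3 * q := by gcongr
      _ = _ := by ring
  have h3 : (1 : ℝ) ≤ E ^ h * (2 / p ^ h) := by
    refine key.trans ?_
    calc _ = (E : ℝ) ^ h * ((p : ℝ) ^ (25 * h - 1 - j) * q * (1 / (p : ℝ) ^ (4 * (10 * h - j))) +
            (p : ℝ) ^ (25 * h - 1 - j) * q * (1 / (q : ℝ) ^ 4)) := by ring
      _ ≤ (E : ℝ) ^ h * (1 / p ^ h + 1 / p ^ h) := by gcongr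
      _ = _ := by ring
  rw [← mul_div_assoc, le_div_iff₀ (by positivity), one_mul] at h3
  have h4 : ((2 * E : ℕ) : ℝ) ^ h < (p : ℝ) ^ h :=
    pow_lt_pow_left₀ (by exact_mod_cast (by omega : 2 * E < p)) (by positivity) (by omega)
  have h5 : (2 : ℝ) ≤ 2 ^ h := le_self_pow₀ (by norm_num) (by omega)
  have h6 : (E : ℝ) ^ h * 2 ≤ ((2 * E : ℕ) : ℝ) ^ h := by
    push_cast
    rw [mul_pow, mul_comm]
    gcongr
  linarith

theorem rat_coords_eq_zero {r : ℝ} (hr : Irrational r) {a b : ℚ} (h : (a : ℝ) + b * r = 0) :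
    a = 0 ∧ b = 0 := by
  have hb : b = 0 := by
    by_contra hb
    have hb' : (b : ℝ) ≠ 0 := by exact_mod_cast hb
    refine hr ⟨-a / b, ?_⟩
    push_cast
    field_simp
    linarith
  subst hb
  simpa using h

theorem rat_coords_eq_zero_of_biquadratic {r s : ℝ} {R S : ℚ} (hR : r ^ 2 = R) (hS : s ^ 2 = S)
    (hr : Irrational r) (hs : Irrational s) (hrs : Irrational (r * s)) {a b c d : ℚ}
    (h : (a : ℝ) + b * r + c * s + d * (r * s) = 0) : a = 0 ∧ b = 0 ∧ c = 0 ∧ d = 0 := by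
  by_cases hcd : c ^ 2 - d ^ 2 * R = 0
  · have h1 : ((c : ℝ) + d * r) * (c + (-d) * r) = 0 := by
      have : ((c : ℝ) ^ 2 - d ^ 2 * R) = 0 := by exact_mod_cast hcd
      linear_combination this - (d : ℝ) ^ 2 * hR
    obtain ⟨rfl, rfl⟩ : c = 0 ∧ d = 0 := by
      rcases mul_eq_zero.1 h1 with h1 | h1
      · exact rat_coords_eq_zero hr h1
      · have := rat_coords_eq_zero hr (a := c) (b := -d) (by push_cast; exact h1)
        simpa using this
    have := rat_coords_eq_zero hr (a := a) (b := b) (by simpa using h)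
    simp [this.1, this.2]
  · exfalso
    have hcd' : ((c : ℝ) ^ 2 - d ^ 2 * R) ≠ 0 := by exact_mod_cast hcd
    obtain ⟨e, f, hef⟩ : ∃ e f : ℚ, s = e + f * r := by
      refine ⟨-(a * c - b * d * R) / (c ^ 2 - d ^ 2 * R), -(b * c - a * d) / (c ^ 2 - d ^ 2 * R), ?_⟩
      push_cast
      field_simp
      linear_combination ((c : ℝ) - d * r) * h + (b * d + d ^ 2 * s) * hR
    have h2 := rat_coords_eq_zero hr (a := e ^ 2 + f ^ 2 * R - S) (b := 2 * e * f) (by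
      push_cast
      rw [hef] at hS
      linear_combination hS - (f : ℝ) ^ 2 * hR)
    rcases mul_eq_zero.1 h2.2 with he | hf
    · have he : e = 0 := by simpa using he
      subst he
      refine hrs ⟨f * R, ?_⟩
      push_cast
      rw [hef]
      push_cast
      linear_combination -(f : ℝ) * hR
    · subst hf
      exact hs ⟨e, by rw [hef]; simp⟩

theorem three_le_natDegree_minpoly {r s : ℝ} {R S y z : ℚ} (hR : r ^ 2 = R) (hS : s ^ 2 = S)
    (hr : Irrational r) (hs : Irrational s) (hrs : Irrational (r * s)) (hy : y ≠ 0)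
    (hSz : S ≠ z ^ 2) (hint : IsIntegral ℚ ((r + y) * (s - z))) :
    3 ≤ (minpoly ℚ ((r + y) * (s - z))).natDegree := by
  by_contra! hlt
  set p := minpoly ℚ ((r + y) * (s - z)) with hp
  have hdeg : p.natDegree < 3 := by omega
  have heval : aeval ((r + y) * (s - z)) p = 0 := minpoly.aeval _ _
  rw [aeval_eq_sum_range' hdeg] at heval
  simp only [Finset.sum_range_succ, Finset.sum_range_zero, Rat.smul_def, pow_zero, pow_one,
    zero_add, mul_one] at heval
  set a := p.coeff 2
  set b := p.coeff 1
  set c := p.coeff 0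
  obtain ⟨h0, h1, h2, h3⟩ := rat_coords_eq_zero_of_biquadratic hR hS hr hs hrs
    (a := a * (R + y ^ 2) * (S + z ^ 2) - b * y * z + c) (b := 2 * y * (S + z ^ 2) * a - z * b)
    (c := -2 * z * (R + y ^ 2) * a + y * b) (d := -4 * y * z * a + b) (by
      push_cast
      linear_combination heval - (a : ℝ) * (s - z) ^ 2 * hR - (a : ℝ) * (R + 2 * y * r + y ^ 2) * hS)
  have ha : a = 0 := by
    have : (2 * y * (S - z ^ 2)) * a = 0 := by linear_combination h1 + z * h3
    rcases mul_eq_zero.1 this with h | h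
    · exact absurd h (mul_ne_zero (mul_ne_zero two_ne_zero hy) (sub_ne_zero.2 hSz))
    · exact h
  have hb : b = 0 := by simpa [ha] using h3
  have hc : c = 0 := by simpa [ha, hb] using h0
  refine minpoly.ne_zero hint ?_
  ext n
  rw [← hp, coeff_zero]
  by_cases hn : n < 3
  · interval_cases n <;> assumption
  · exact coeff_eq_zero_of_natDegree_lt (by omega)

theorem sq_den_mul_le {D₁ D₂ c₁ c₂ x₀ y₀ z₀ x y z : ℤ} (hc₁ : c₁ ≠ 0) (hc₂ : c₂ ≠ 0)
    (hE : c₂ * D₁ ≠ c₁ * D₂) (hx₀ : 0 < x₀) (hz₀ : 0 < z₀)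
    (hx : x₀ < x) (hz : 0 ≤ z) (hyz : 0 ≤ z₀ * y + y₀ * z)
    (h₁ : y₀ ^ 2 = D₁ * x₀ ^ 2 + c₁) (h₂ : z₀ ^ 2 = D₂ * x₀ ^ 2 + c₂)
    (h₃ : y ^ 2 = D₁ * x ^ 2 + c₁) (h₄ : z ^ 2 = D₂ * x ^ 2 + c₂) :
    (((y * x₀ + y₀ * x : ℤ) / (z * x₀ + z₀ * x : ℤ) : ℚ).den : ℤ) ^ 2 * (x ^ 2 - x₀ ^ 2) ≤
      |c₂| * |y * x₀ - y₀ * x| * x₀ * (z * x₀ + z₀ * x) * (z₀ * y + y₀ * z) := by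
  set A := y * x₀ - y₀ * x with hA
  set B := y * x₀ + y₀ * x with hB
  set C := z * x₀ - z₀ * x with hC
  set G := z * x₀ + z₀ * x with hG
  set E := c₂ * D₁ - c₁ * D₂ with hE'
  have hE0 : E ≠ 0 := sub_ne_zero.2 hE
  have hxx : 0 < x ^ 2 - x₀ ^ 2 := by nlinarith
  have hGpos : 0 < G := by
    have : 0 < z₀ * x := mul_pos hz₀ (hx₀.trans hx)
    have : 0 ≤ z * x₀ := by positivity
    omega
  have hAB : A * B = c₁ * (x₀ ^ 2 - x ^ 2) := by
    linear_combination x₀ ^ 2 * h₃ - x ^ 2 * h₁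
  have hCG : C * G = c₂ * (x₀ ^ 2 - x ^ 2) := by
    linear_combination x₀ ^ 2 * h₄ - x ^ 2 * h₂
  have hA0 : A ≠ 0 := by
    intro h
    rw [h, zero_mul] at hAB
    rcases mul_eq_zero.1 hAB.symm with h | h
    · exact hc₁ h
    · omega
  set t : ℚ := ((B : ℚ) / (G : ℚ)) with ht
  set p := t.num with hp
  set q : ℤ := (t.den : ℤ) with hq
  have hqpos : 0 < q := Int.natCast_pos.2 t.den_pos
  have hcop : IsCoprime p q := by
    rw [Int.isCoprime_iff_gcd_eq_one]
    exact t.reduced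
  have hBG : B * q = p * G := by
    have h1 : (t : ℚ) = p / q := by
      rw [hp, hq]; exact_mod_cast (Rat.num_div_den t).symm
    have hG' : (G : ℚ) ≠ 0 := by exact_mod_cast hGpos.ne'
    have hq' : (q : ℚ) ≠ 0 := by exact_mod_cast hqpos.ne'
    rw [ht, div_eq_div_iff hG' hq'] at h1
    exact_mod_cast h1
  obtain ⟨w, hw⟩ : q ∣ G := hcop.symm.dvd_of_dvd_mul_left (Dvd.intro_left B hBG)
  have hBw : B = p * w := by
    have : B * q = (p * w) * q := by rw [hBG, hw]; ring
    exact mul_right_cancel₀ hqpos.ne' this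
  have hwpos : 0 < w := by
    rw [hw] at hGpos
    exact pos_of_mul_pos_right hGpos hqpos.le
  have hACp : c₂ * A * p = c₁ * C * q := by
    refine mul_right_cancel₀ hwpos.ne' ?_
    calc c₂ * A * p * w = c₂ * (A * B) := by rw [hBw]; ring
      _ = c₁ * (C * G) := by rw [hAB, hCG]; ring
      _ = c₁ * C * q * w := by rw [hw]; ring
  obtain ⟨v, hv⟩ : q ∣ c₂ * A :=
    hcop.symm.dvd_of_dvd_mul_right (Dvd.intro_left (c₁ * C) hACp.symm)
  have hCv : c₁ * C = v * p := by
    refine mul_right_cancel₀ hqpos.ne' ?_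
    rw [← hACp, hv]; ring
  have hv0 : v ≠ 0 := by
    rintro rfl
    exact mul_ne_zero hc₂ hA0 (by simpa using hv)
  set N := z₀ * p - y₀ * q with hN
  set M := c₁ * z₀ * q - c₂ * y₀ * p with hM
  have hNw : N * w = x₀ * (z₀ * y - y₀ * z) := by
    linear_combination -z₀ * hBw + y₀ * hw
  have hvM : v * M = c₁ * c₂ * w * N := by
    linear_combination -c₁ * z₀ * hv + c₂ * y₀ * hCv - c₁ * c₂ * hNw
  have hdvd : N ∣ v * E * x₀ ^ 2 := by
    have e1 : N ∣ v * E * x₀ ^ 2 * q :=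
      ⟨-(z₀ * (c₁ * c₂ * w) + v * c₂ * y₀), by
        linear_combination -z₀ * hvM + v * q * c₁ * h₂ - v * q * c₂ * h₁⟩
    have e2 : N ∣ v * E * x₀ ^ 2 * p :=
      ⟨-(y₀ * (c₁ * c₂ * w) + v * c₁ * z₀), by
        linear_combination -y₀ * hvM + v * p * c₁ * h₂ - v * p * c₂ * h₁⟩
    obtain ⟨u₁, u₂, hu⟩ := hcop
    have : v * E * x₀ ^ 2 = u₁ * (v * E * x₀ ^ 2 * p) + u₂ * (v * E * x₀ ^ 2 * q) := by
      linear_combination -(v * E * x₀ ^ 2) * hu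
    rw [this]
    exact dvd_add (Dvd.dvd.mul_left e2 _) (Dvd.dvd.mul_left e1 _)
  have hNle : |N| ≤ |v| * |E| * x₀ ^ 2 := by
    have h0 : v * E * x₀ ^ 2 ≠ 0 := by positivity
    have := Int.le_of_dvd (abs_pos.2 h0) ((abs_dvd_abs _ _).2 hdvd)
    rwa [abs_mul, abs_mul, abs_pow, abs_of_pos hx₀] at this
  have hqN : q * |N| ≤ |c₂| * |A| * |E| * x₀ ^ 2 := by
    have : |c₂| * |A| = q * |v| := by rw [← abs_mul, hv, abs_mul, abs_of_pos hqpos]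
    calc q * |N| ≤ q * (|v| * |E| * x₀ ^ 2) := by gcongr
      _ = _ := by rw [this]; ring
  have hdiff : N * w * (z₀ * y + y₀ * z) = x₀ * (E * (x ^ 2 - x₀ ^ 2)) := by
    rw [hNw]
    linear_combination x₀ * z₀ ^ 2 * h₃ - x₀ * y₀ ^ 2 * h₄ + x₀ * (D₁ * x ^ 2 + c₁) * h₂ -
      x₀ * (D₂ * x ^ 2 + c₂) * h₁
  have hdiff' : |N| * w * (z₀ * y + y₀ * z) = x₀ * (|E| * (x ^ 2 - x₀ ^ 2)) := by
    have := congrArg abs hdiff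
    rwa [abs_mul, abs_mul, abs_mul, abs_mul, abs_of_pos hwpos, abs_of_nonneg hyz, abs_of_pos hx₀,
      abs_of_pos hxx] at this
  have hEpos : 0 < |E| := abs_pos.2 hE0
  refine le_of_mul_le_mul_left ?_ (mul_pos hx₀ hEpos)
  calc x₀ * |E| * (q ^ 2 * (x ^ 2 - x₀ ^ 2)) = q * |N| * (q * w) * (z₀ * y + y₀ * z) := by
        linear_combination -q ^ 2 * hdiff'
    _ ≤ |c₂| * |A| * |E| * x₀ ^ 2 * (q * w) * (z₀ * y + y₀ * z) := by
        have : 0 ≤ q * w := by positivity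
        gcongr
    _ = _ := by rw [hw]; ring

theorem exists_pos_forall_le_abs_sub {τ : ℝ} (hτ : Irrational τ) {T : Set ℚ} (hT : T.Finite) :
    ∃ δ > 0, ∀ t ∈ T, δ ≤ |τ - t| := by
  rcases T.eq_empty_or_nonempty with rfl | hne
  · exact ⟨1, one_pos, by simp⟩
  · obtain ⟨t₀, -, h⟩ := T.exists_min_image (fun t : ℚ => |τ - t|) hT hne
    exact ⟨|τ - t₀|, abs_pos.2 (sub_ne_zero.2 (hτ.ne_rat t₀)), h⟩

theorem irrational_of_three_le_natDegree {τ : ℝ} (h : 3 ≤ (minpoly ℚ τ).natDegree) :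
    Irrational τ := by
  rintro ⟨q, rfl⟩
  have : minpoly ℚ (q : ℝ) = X - C q := minpoly.eq_X_sub_C ℝ q
  rw [this, natDegree_X_sub_C] at h
  omega

theorem abs_sub_sqrt_mul_le {D c x y : ℝ} (hD : 1 ≤ D) (hx : 1 ≤ x) (hy : 0 ≤ y)
    (h : y ^ 2 = D * x ^ 2 + c) : |y - √D * x| ≤ |c| / x := by
  have hs : 1 ≤ √D := Real.one_le_sqrt.2 hD
  have hsq : √D ^ 2 = D := Real.sq_sqrt (by linarith)
  have hmul : |y - √D * x| * (y + √D * x) = |c| := by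
    rw [← abs_of_nonneg (a := y + √D * x) (by positivity), ← abs_mul]
    congr 1
    linear_combination h - x ^ 2 * hsq
  rw [le_div_iff₀ (by linarith), ← hmul]
  gcongr
  nlinarith

theorem abs_sub_div_le {D₁ D₂ c₁ c₂ x₀ y₀ z₀ x y z : ℝ} (hD₁ : 1 ≤ D₁) (hD₂ : 1 ≤ D₂)
    (hx₀ : 0 < x₀) (hy₀ : 0 ≤ y₀) (hz₀ : 1 ≤ z₀) (hx : 1 ≤ x) (hy : 0 ≤ y) (hz : 0 ≤ z)
    (h₃ : y ^ 2 = D₁ * x ^ 2 + c₁) (h₄ : z ^ 2 = D₂ * x ^ 2 + c₂) :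
    |(√D₁ * x₀ + y₀) / (√D₂ * x₀ + z₀) - (y * x₀ + y₀ * x) / (z * x₀ + z₀ * x)| ≤
      x₀ * (|c₁| * (√D₂ * x₀ + z₀) + |c₂| * (√D₁ * x₀ + y₀)) / x ^ 2 := by
  have e₁ := abs_sub_sqrt_mul_le hD₁ hx hy h₃
  have e₂ := abs_sub_sqrt_mul_le hD₂ hx hz h₄
  set u := √D₁ * x₀ + y₀ with hu
  set v := √D₂ * x₀ + z₀ with hv
  have hu0 : 0 ≤ u := by positivity
  have hv1 : 1 ≤ v := by
    have : 0 ≤ √D₂ * x₀ := by positivity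
    linarith
  have hG : x ≤ z * x₀ + z₀ * x := by
    have : 0 ≤ z * x₀ := by positivity
    nlinarith
  have hG0 : 0 < z * x₀ + z₀ * x := by linarith
  have hid : u / v - (y * x₀ + y₀ * x) / (z * x₀ + z₀ * x) =
      x₀ * ((z - √D₂ * x) * u - (y - √D₁ * x) * v) / (v * (z * x₀ + z₀ * x)) := by
    rw [div_sub_div _ _ (by linarith) hG0.ne']
    congr 1
    rw [hu, hv]
    ring
  rw [hid, abs_div, abs_mul, abs_of_pos hx₀, abs_of_pos (mul_pos (by linarith) hG0)]
  have hnum : |(z - √D₂ * x) * u - (y - √D₁ * x) * v| ≤ (|c₁| * v + |c₂| * u) / x := by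
    calc |(z - √D₂ * x) * u - (y - √D₁ * x) * v|
        ≤ |(z - √D₂ * x) * u| + |(y - √D₁ * x) * v| := abs_sub _ _
      _ = |z - √D₂ * x| * u + |y - √D₁ * x| * v := by
          rw [abs_mul, abs_mul, abs_of_nonneg hu0, abs_of_nonneg (by linarith : 0 ≤ v)]
      _ ≤ |c₂| / x * u + |c₁| / x * v := by gcongr
      _ = _ := by ring
  calc x₀ * |(z - √D₂ * x) * u - (y - √D₁ * x) * v| / (v * (z * x₀ + z₀ * x))
      ≤ x₀ * ((|c₁| * v + |c₂| * u) / x) / (1 * x) := by gcongr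
    _ = _ := by field_simp

theorem exists_den_sq_le {D₁ D₂ c₁ c₂ x₀ y₀ z₀ : ℤ} (hD₁ : 0 < D₁) (hD₂ : 0 < D₂)
    (hc₁ : c₁ ≠ 0) (hc₂ : c₂ ≠ 0)
    (hE : c₂ * D₁ ≠ c₁ * D₂) (hx₀ : 0 < x₀) (hy₀ : 0 < y₀) (hz₀ : 0 < z₀)
    (h₁ : y₀ ^ 2 = D₁ * x₀ ^ 2 + c₁) (h₂ : z₀ ^ 2 = D₂ * x₀ ^ 2 + c₂) :
    ∃ K : ℤ, 0 ≤ K ∧ ∀ x y z : ℤ, 2 * x₀ ≤ x → 0 ≤ y → 0 ≤ z →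
      y ^ 2 = D₁ * x ^ 2 + c₁ → z ^ 2 = D₂ * x ^ 2 + c₂ →
      (((y * x₀ + y₀ * x : ℤ) / (z * x₀ + z₀ * x : ℤ) : ℚ).den : ℤ) ^ 2 ≤ K * x := by
  have hlin : ∀ D c x y : ℤ, 0 < D → 1 ≤ x → 0 ≤ y → y ^ 2 = D * x ^ 2 + c →
      y ≤ (D + |c|) * x := by
    intro D c x y hD hx hy h
    have hc := le_abs_self c
    have hc0 := abs_nonneg c
    have h1 : (1 : ℤ) ≤ D + |c| := by omega
    refine abs_le_of_sq_le_sq' ?_ (by positivity) |>.2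
    rw [h]
    calc D * x ^ 2 + c ≤ D * x ^ 2 + |c| * x ^ 2 := by nlinarith [mul_le_mul hx hx zero_le_one (by omega)]
      _ = (D + |c|) * x ^ 2 := by ring
      _ ≤ (D + |c|) ^ 2 * x ^ 2 := by
          gcongr
          nlinarith
      _ = _ := by ring
  set L₁ := D₁ + |c₁|
  set L₂ := D₂ + |c₂|
  have hL₁ : 0 < L₁ := by positivity
  have hL₂ : 0 < L₂ := by positivity
  refine ⟨2 * (|c₂| * |c₁| * x₀ * (L₂ * x₀ + z₀) * (z₀ * L₁ + y₀ * L₂)), by positivity, ?_⟩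
  intro x y z hx hy hz h₃ h₄
  have hx1 : 1 ≤ x := by omega
  have hyL := hlin D₁ c₁ x y hD₁ hx1 hy h₃
  have hzL := hlin D₂ c₂ x z hD₂ hx1 hz h₄
  have hmain := sq_den_mul_le hc₁ hc₂ hE hx₀ hz₀ (by omega) hz (by positivity) h₁ h₂ h₃ h₄
  set q : ℤ := (((y * x₀ + y₀ * x : ℤ) / (z * x₀ + z₀ * x : ℤ) : ℚ).den : ℤ)
  have hA : |y * x₀ - y₀ * x| ≤ |c₁| * x := by
    have hAB : |y * x₀ - y₀ * x| * (y * x₀ + y₀ * x) = |c₁| * (x ^ 2 - x₀ ^ 2) := by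
      rw [← abs_of_nonneg (a := y * x₀ + y₀ * x) (by positivity), ← abs_mul,
        ← abs_of_nonneg (a := x ^ 2 - x₀ ^ 2) (by nlinarith), ← abs_mul, ← abs_neg]
      congr 1
      linear_combination -x₀ ^ 2 * h₃ + x ^ 2 * h₁
    refine le_of_mul_le_mul_right ?_ (by omega : 0 < x)
    calc |y * x₀ - y₀ * x| * x ≤ |y * x₀ - y₀ * x| * (y * x₀ + y₀ * x) := by
          gcongr
          have : 0 ≤ y * x₀ := by positivity
          nlinarith
      _ = |c₁| * (x ^ 2 - x₀ ^ 2) := hAB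
      _ ≤ |c₁| * (x * x) := by
          gcongr
          nlinarith
      _ = |c₁| * x * x := by ring
  have hq : q ^ 2 * x ^ 2 ≤ 2 * (q ^ 2 * (x ^ 2 - x₀ ^ 2)) := by
    have : x ^ 2 ≤ 2 * (x ^ 2 - x₀ ^ 2) := by nlinarith
    calc q ^ 2 * x ^ 2 ≤ q ^ 2 * (2 * (x ^ 2 - x₀ ^ 2)) := by gcongr
      _ = _ := by ring
  refine le_of_mul_le_mul_right ?_ (by positivity : 0 < x ^ 2)
  calc q ^ 2 * x ^ 2 ≤ 2 * (q ^ 2 * (x ^ 2 - x₀ ^ 2)) := hq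
    _ ≤ 2 * (|c₂| * |y * x₀ - y₀ * x| * x₀ * (z * x₀ + z₀ * x) * (z₀ * y + y₀ * z)) := by gcongr
    _ ≤ 2 * (|c₂| * (|c₁| * x) * x₀ * (L₂ * x * x₀ + z₀ * x) *
          (z₀ * (L₁ * x) + y₀ * (L₂ * x))) := by gcongr
    _ = _ := by ring

theorem mul_pow_four_eq_of_sq_eq {R : Type*} [CommRing R] {u v a b c d : R}
    (hu : u ^ 2 = a * u + b) (hv : v ^ 2 = c * v + d) :
    (u * v) ^ 4 = -(b ^ 2 * d ^ 2) + a * b * c * d * (u * v) +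
      (a ^ 2 * d + b * c ^ 2 + 2 * b * d) * (u * v) ^ 2 + a * c * (u * v) ^ 3 := by
  grind

theorem exists_large_mem {S : Set ℤ} (h0 : ∀ x ∈ S, 0 ≤ x) (h : S.Infinite) (M : ℤ) :
    ∃ x ∈ S, M < x := by
  by_contra! hM
  exact h ((Set.finite_Icc 0 M).subset fun x hx => ⟨h0 x hx, hM x hx⟩)

/-- Simultaneous Pell equations attached to independent quadratic fields. -/
theorem finite_simultaneous_pell_of_not_isSquare {D₁ D₂ c₁ c₂ : ℤ} (hD₁ : 0 < D₁) (hD₂ : 0 < D₂)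
    (hs₁ : ¬IsSquare D₁) (hs₂ : ¬IsSquare D₂) (hs₁₂ : ¬IsSquare (D₁ * D₂))
    (hc₁ : c₁ ≠ 0) (hc₂ : c₂ ≠ 0) (hE : c₂ * D₁ ≠ c₁ * D₂) :
    {x : ℤ | 0 ≤ x ∧ ∃ y z : ℤ, 0 ≤ y ∧ 0 ≤ z ∧ y ^ 2 = D₁ * x ^ 2 + c₁ ∧
      z ^ 2 = D₂ * x ^ 2 + c₂}.Finite := by
  by_contra hinf
  have hlarge := exists_large_mem (fun x hx => hx.1) hinf
  obtain ⟨x₀, ⟨-, y₀, z₀, hy₀', hz₀', h₁, h₂⟩, hx₀⟩ := hlarge (|c₁| + |c₂|)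
  have hc₁' := abs_nonneg c₁
  have hc₂' := abs_nonneg c₂
  have hx₀0 : 0 < x₀ := by omega
  have hne : ∀ D c y : ℤ, 0 < D → |c| < x₀ → 0 ≤ y → y ^ 2 = D * x₀ ^ 2 + c → 0 < y := by
    intro D c y hD hc hy h
    refine lt_of_le_of_ne hy ?_
    rintro rfl
    have := neg_abs_le c
    nlinarith [mul_pos hD (sq_pos_of_pos hx₀0)]
  have hy₀ : 0 < y₀ := hne D₁ c₁ y₀ hD₁ (by omega) hy₀' h₁
  have hz₀ : 0 < z₀ := hne D₂ c₂ z₀ hD₂ (by omega) hz₀' h₂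
  obtain ⟨K, hK0, hK⟩ := exists_den_sq_le hD₁ hD₂ hc₁ hc₂ hE hx₀0 hy₀ hz₀ h₁ h₂
  have hD₁R : (1 : ℝ) ≤ D₁ := by exact_mod_cast hD₁
  have hD₂R : (1 : ℝ) ≤ D₂ := by exact_mod_cast hD₂
  have hsq₁ : √(D₁ : ℝ) ^ 2 = D₁ := Real.sq_sqrt (by linarith)
  have hsq₂ : √(D₂ : ℝ) ^ 2 = D₂ := Real.sq_sqrt (by linarith)
  have h₁R : (y₀ : ℝ) ^ 2 = D₁ * x₀ ^ 2 + c₁ := by exact_mod_cast h₁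
  have h₂R : (z₀ : ℝ) ^ 2 = D₂ * x₀ ^ 2 + c₂ := by exact_mod_cast h₂
  set r : ℝ := √(D₁ : ℝ) * x₀ with hr
  set s : ℝ := √(D₂ : ℝ) * x₀ with hs
  have hr2 : r ^ 2 = y₀ ^ 2 - c₁ := by rw [hr]; linear_combination x₀ ^ 2 * hsq₁ - h₁R
  have hs2 : s ^ 2 = z₀ ^ 2 - c₂ := by rw [hs]; linear_combination x₀ ^ 2 * hsq₂ - h₂R
  set τ : ℝ := (r + y₀) * (s - z₀) with hτ
  have hτ4 : τ ^ 4 = ∑ l, ((![-(c₁ ^ 2 * c₂ ^ 2), -(4 * y₀ * z₀ * c₁ * c₂),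
      -(c₂ * (4 * y₀ ^ 2 - 2 * c₁) + 4 * z₀ ^ 2 * c₁), -(4 * y₀ * z₀)] : Fin 4 → ℤ) l : ℝ) *
        τ ^ (l : ℕ) := by
    simp only [Fin.sum_univ_four, Matrix.cons_val]
    have hu : (r + y₀) ^ 2 = 2 * y₀ * (r + y₀) + -c₁ := by linear_combination hr2
    have hv : (s - z₀) ^ 2 = -2 * z₀ * (s - z₀) + -c₂ := by linear_combination hs2
    rw [mul_pow_four_eq_of_sq_eq hu hv]
    simp
    ring
  have hx₀R : (x₀ : ℝ) ≠ 0 := by exact_mod_cast hx₀0.ne'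
  have hirr₁ : Irrational r :=
    ((irrational_sqrt_intCast_iff_of_nonneg hD₁.le).2 hs₁).mul_intCast hx₀0.ne'
  have hirr₂ : Irrational s :=
    ((irrational_sqrt_intCast_iff_of_nonneg hD₂.le).2 hs₂).mul_intCast hx₀0.ne'
  have hirr₁₂ : Irrational (r * s) := by
    have := ((irrational_sqrt_intCast_iff_of_nonneg (mul_pos hD₁ hD₂).le).2 hs₁₂).mul_intCast
      (pow_pos hx₀0 2).ne'
    convert this using 1
    push_cast
    rw [Real.sqrt_mul (by linarith), hr, hs]
    ring
  have hint : IsIntegral ℚ τ := by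
    refine ⟨X ^ 4 - ∑ l : Fin 4, C ((![-(c₁ ^ 2 * c₂ ^ 2), -(4 * y₀ * z₀ * c₁ * c₂),
      -(c₂ * (4 * y₀ ^ 2 - 2 * c₁) + 4 * z₀ ^ 2 * c₁), -(4 * y₀ * z₀)] : Fin 4 → ℤ) l : ℚ) *
        X ^ (l : ℕ), monic_X_pow_sub (degree_sum_fin_lt _), ?_⟩
    simp only [eval₂_sub, eval₂_X_pow, eval₂_finsetSum, eval₂_mul, eval₂_C, eq_ratCast,
      Rat.cast_intCast]
    rw [hτ4, sub_self]
  have hdeg : 3 ≤ (minpoly ℚ τ).natDegree := by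
    have := three_le_natDegree_minpoly (r := r) (s := s) (R := (D₁ * x₀ ^ 2 : ℤ))
      (S := (D₂ * x₀ ^ 2 : ℤ)) (y := y₀) (z := z₀)
      (by push_cast; rw [hr]; linear_combination x₀ ^ 2 * hsq₁)
      (by push_cast; rw [hs]; linear_combination x₀ ^ 2 * hsq₂) hirr₁ hirr₂ hirr₁₂
      (by exact_mod_cast hy₀.ne') (by norm_cast; omega) (by simpa using hint)
    simpa using this
  have hv0 : 0 < s + z₀ := by positivity
  set κ : ℝ := |(c₂ : ℝ)| * (x₀ * (|(c₁ : ℝ)| * (s + z₀) + |(c₂ : ℝ)| * (r + y₀))) with hκ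
  have hκ0 : 0 ≤ κ := by positivity
  have hfin := finite_rat_approx_of_quartic hτ4 hdeg (κ * K ^ 2)
  obtain ⟨δ, hδ, hδT⟩ :=
    exists_pos_forall_le_abs_sub (irrational_of_three_le_natDegree hdeg) hfin
  obtain ⟨x, ⟨-, y, z, hy, hz, h₃, h₄⟩, hx⟩ := hlarge (max (2 * x₀) ⌈κ / δ⌉)
  have hx2 : 2 * x₀ ≤ x := ((le_max_left _ _).trans_lt hx).le
  have hxκ : κ / δ < x := (Int.le_ceil _).trans_lt
    (by exact_mod_cast (le_max_right _ _).trans_lt hx)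
  have hx1 : (1 : ℝ) ≤ x := by exact_mod_cast (by omega : 1 ≤ x)
  set t : ℚ := ((y * x₀ + y₀ * x : ℤ) / (z * x₀ + z₀ * x : ℤ) : ℚ) with ht
  have hclose : |τ - ((-c₂ * t : ℚ) : ℝ)| ≤ κ / x ^ 2 := by
    have h := abs_sub_div_le hD₁R hD₂R (x₀ := x₀) (y₀ := y₀) (z₀ := z₀) (c₁ := c₁) (c₂ := c₂)
      (x := x) (y := y) (z := z)
      (by exact_mod_cast hx₀0) (by exact_mod_cast hy₀.le) (by exact_mod_cast hz₀) hx1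
      (by exact_mod_cast hy) (by exact_mod_cast hz) (by exact_mod_cast h₃) (by exact_mod_cast h₄)
    have hτ' : τ - ((-c₂ * t : ℚ) : ℝ) = -c₂ * ((r + y₀) / (s + z₀) -
        (y * x₀ + y₀ * x) / (z * x₀ + z₀ * x)) := by
      have : τ = -c₂ * ((r + y₀) / (s + z₀)) := by
        rw [← mul_div_assoc, eq_div_iff hv0.ne', hτ]
        linear_combination (r + y₀) * hs2
      rw [this, ht]
      push_cast
      ring
    rw [hτ', abs_mul, abs_neg, hκ, mul_div_assoc]
    gcongr
  have hden : ((-c₂ * t : ℚ).den : ℝ) ^ 4 ≤ K ^ 2 * x ^ 2 := by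
    have hd : ((-c₂ * t : ℚ).den : ℤ) ≤ t.den := by
      have h := Rat.mul_den_dvd (-c₂ : ℚ) t
      rw [show (-c₂ : ℚ).den = 1 by exact_mod_cast Rat.den_intCast (-c₂), one_mul] at h
      exact_mod_cast Nat.le_of_dvd t.den_pos h
    have h2 : ((-c₂ * t : ℚ).den : ℤ) ^ 2 ≤ K * x :=
      (pow_le_pow_left₀ (by positivity) hd 2).trans (hK x y z hx2 hy hz h₃ h₄)
    calc ((-c₂ * t : ℚ).den : ℝ) ^ 4 = (((-c₂ * t : ℚ).den : ℝ) ^ 2) ^ 2 := by ring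
      _ ≤ ((K : ℝ) * x) ^ 2 := by
          gcongr
          exact_mod_cast h2
      _ = _ := by ring
  have hmem : (-c₂ * t : ℚ) ∈ {t : ℚ | |τ - t| ≤ κ * K ^ 2 / (t.den : ℝ) ^ 4} := by
    have hd0 : (0 : ℝ) < ((-c₂ * t : ℚ).den : ℝ) ^ 4 := by
      have := (-c₂ * t : ℚ).den_pos
      positivity
    refine hclose.trans ?_
    rw [div_le_div_iff₀ (by positivity) hd0]
    linarith [mul_le_mul_of_nonneg_left hden hκ0]
  have hlow := (hδT _ hmem).trans hclose
  rw [le_div_iff₀ (by positivity)] at hlow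
  rw [div_lt_iff₀ hδ] at hxκ
  nlinarith

end

theorem finite_simultaneous_pell_of_isSquare {D₁ D₂ c₁ c₂ : ℤ} (hD₁ : 0 < D₁) (hD₂ : 0 < D₂)
    (hs₁₂ : IsSquare (D₁ * D₂)) (hE : c₂ * D₁ ≠ c₁ * D₂) :
    {x : ℤ | 0 ≤ x ∧ ∃ y z : ℤ, 0 ≤ y ∧ 0 ≤ z ∧ y ^ 2 = D₁ * x ^ 2 + c₁ ∧
      z ^ 2 = D₂ * x ^ 2 + c₂}.Finite := by
  obtain ⟨d, hd⟩ := hs₁₂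
  set e := c₁ * D₂ + c₂ * D₁ with he
  set k := (c₂ * D₁ - c₁ * D₂) ^ 2 with hk
  have hk0 : 0 < k := by
    have : c₂ * D₁ - c₁ * D₂ ≠ 0 := sub_ne_zero.2 hE
    positivity
  refine (Set.finite_Icc 0 (k + |e|)).subset ?_
  rintro x ⟨hx, y, z, -, -, h₁, h₂⟩
  refine ⟨hx, ?_⟩
  have hprod : (2 * (D₁ * D₂) * x ^ 2 + e + 2 * d * y * z) *
      (2 * (D₁ * D₂) * x ^ 2 + e - 2 * d * y * z) = k := by
    linear_combination 4 * (y ^ 2 * z ^ 2) * hd - 4 * D₁ * D₂ * z ^ 2 * h₁ -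
      4 * D₁ * D₂ * (D₁ * x ^ 2 + c₁) * h₂
  have h3 := Int.le_of_dvd hk0 (Dvd.intro _ hprod)
  have h4 := Int.le_of_dvd hk0 (Dvd.intro_left _ hprod)
  have h5 := neg_abs_le e
  nlinarith [mul_pos hD₁ hD₂, sq_nonneg x, Int.le_self_sq x]

theorem finite_simultaneous_pell {D₁ D₂ c₁ c₂ : ℤ} (hD₁ : 0 < D₁) (hD₂ : 0 < D₂)
    (hs₁ : ¬IsSquare D₁) (hs₂ : ¬IsSquare D₂) (hc₁ : c₁ ≠ 0) (hc₂ : c₂ ≠ 0)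
    (hE : c₂ * D₁ ≠ c₁ * D₂) :
    {x : ℤ | ∃ y z : ℤ, y ^ 2 = D₁ * x ^ 2 + c₁ ∧ z ^ 2 = D₂ * x ^ 2 + c₂}.Finite := by
  have hfin : {x : ℤ | 0 ≤ x ∧ ∃ y z : ℤ, 0 ≤ y ∧ 0 ≤ z ∧ y ^ 2 = D₁ * x ^ 2 + c₁ ∧
      z ^ 2 = D₂ * x ^ 2 + c₂}.Finite := by
    by_cases h : IsSquare (D₁ * D₂)
    · exact finite_simultaneous_pell_of_isSquare hD₁ hD₂ h hE
    · exact finite_simultaneous_pell_of_not_isSquare hD₁ hD₂ hs₁ hs₂ h hc₁ hc₂ hE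
  refine (hfin.union (hfin.image Neg.neg)).subset ?_
  rintro x ⟨y, z, h₁, h₂⟩
  have habs : ∃ y z : ℤ, 0 ≤ y ∧ 0 ≤ z ∧ y ^ 2 = D₁ * x ^ 2 + c₁ ∧ z ^ 2 = D₂ * x ^ 2 + c₂ :=
    ⟨|y|, |z|, abs_nonneg y, abs_nonneg z, by rwa [sq_abs], by rwa [sq_abs]⟩
  rcases le_total 0 x with hx | hx
  · exact Or.inl ⟨hx, habs⟩
  · exact Or.inr ⟨-x, ⟨neg_nonneg.2 hx, by simpa only [neg_sq] using habs⟩, neg_neg x⟩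

theorem lucasV_sq (P Q : ℤ) (n : ℕ) :
    lucasV P Q n ^ 2 = (P ^ 2 - 4 * Q) * lucasU P Q n ^ 2 + 4 * Q ^ n := by
  suffices h : lucasV P Q n ^ 2 = (P ^ 2 - 4 * Q) * lucasU P Q n ^ 2 + 4 * Q ^ n ∧
      lucasV P Q (n + 1) ^ 2 = (P ^ 2 - 4 * Q) * lucasU P Q (n + 1) ^ 2 + 4 * Q ^ (n + 1) ∧
      lucasV P Q n * lucasV P Q (n + 1) =
        (P ^ 2 - 4 * Q) * (lucasU P Q n * lucasU P Q (n + 1)) + 2 * P * Q ^ n from h.1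
  induction n with
  | zero =>
    simp only [lucasU, lucasV]
    refine ⟨?_, ?_, ?_⟩ <;> ring
  | succ n ih =>
    obtain ⟨h₁, h₂, h₃⟩ := ih
    refine ⟨h₂, ?_, ?_⟩
    · simp only [lucasU, lucasV]
      linear_combination P ^ 2 * h₂ + Q ^ 2 * h₁ - 2 * P * Q * h₃
    · simp only [lucasU, lucasV]
      linear_combination P * h₂ - Q * h₃

theorem not_isSquare_sq_sub_four_mul {P Q : ℤ} (hP : 0 < P) (hQ : |Q| = 1)
    (hnd : (P, Q) ≠ (1, 1) ∧ (P, Q) ≠ (2, 1)) :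
    0 < P ^ 2 - 4 * Q ∧ ¬IsSquare (P ^ 2 - 4 * Q) := by
  rcases (abs_eq zero_le_one).1 hQ with rfl | rfl
  · have hP3 : 3 ≤ P := by
      by_contra! h
      interval_cases P <;> simp at hnd
    refine ⟨by nlinarith, ?_⟩
    rintro ⟨k, hk⟩
    rw [← abs_mul_abs_self k] at hk
    have hk0 := abs_nonneg k
    have h1 : |k| < P := by nlinarith
    have h2 : P - 2 < |k| := by nlinarith
    have h3 : |k| = P - 1 := by omega
    rw [h3] at hk
    have : 2 * P = 5 := by linarith
    omega
  · refine ⟨by nlinarith, ?_⟩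
    rintro ⟨k, hk⟩
    rw [← abs_mul_abs_self k] at hk
    have hk0 := abs_nonneg k
    have h1 : P < |k| := by nlinarith
    have h2 : |k| < P + 2 := by nlinarith
    have h3 : |k| = P + 1 := by omega
    rw [h3] at hk
    have : 2 * P = 3 := by linarith
    omega

theorem finite_inter_lucasU {P₁ Q₁ P₂ Q₂ : ℤ} (hP₁ : 0 < P₁) (hP₂ : 0 < P₂)
    (hQ₁ : |Q₁| = 1) (hQ₂ : |Q₂| = 1)
    (hnd₁ : (P₁, Q₁) ≠ (1, 1) ∧ (P₁, Q₁) ≠ (2, 1))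
    (hnd₂ : (P₂, Q₂) ≠ (1, 1) ∧ (P₂, Q₂) ≠ (2, 1))
    (hD : P₁ ^ 2 - 4 * Q₁ ≠ P₂ ^ 2 - 4 * Q₂) :
    ({x : ℤ | ∃ n : ℕ, x = lucasU P₁ Q₁ n} ∩ {x : ℤ | ∃ m : ℕ, x = lucasU P₂ Q₂ m}).Finite := by
  obtain ⟨hD₁, hs₁⟩ := not_isSquare_sq_sub_four_mul hP₁ hQ₁ hnd₁
  obtain ⟨hD₂, hs₂⟩ := not_isSquare_sq_sub_four_mul hP₂ hQ₂ hnd₂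
  have hpow : ∀ (Q : ℤ) (n : ℕ), |Q| = 1 → 4 * Q ^ n ∈ ({4, -4} : Set ℤ) := by
    intro Q n hQ
    rcases (abs_eq zero_le_one).1 (by rw [abs_pow, hQ, one_pow] : |Q ^ n| = 1) with h | h <;>
      simp [h]
  have hfin : (⋃ c₁ ∈ ({4, -4} : Set ℤ), ⋃ c₂ ∈ ({4, -4} : Set ℤ),
      {x : ℤ | ∃ y z : ℤ, y ^ 2 = (P₁ ^ 2 - 4 * Q₁) * x ^ 2 + c₁ ∧
        z ^ 2 = (P₂ ^ 2 - 4 * Q₂) * x ^ 2 + c₂}).Finite := by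
    refine Set.Finite.biUnion (by simp) fun c₁ hc₁ => Set.Finite.biUnion (by simp) fun c₂ hc₂ => ?_
    refine finite_simultaneous_pell hD₁ hD₂ hs₁ hs₂ ?_ ?_ ?_ <;>
    · rcases hc₁ with rfl | rfl <;> rcases hc₂ with rfl | rfl <;> omega
  refine hfin.subset ?_
  rintro x ⟨⟨n, hn⟩, m, hm⟩
  simp only [Set.mem_iUnion]
  exact ⟨_, hpow Q₁ n hQ₁, _, hpow Q₂ m hQ₂, lucasV P₁ Q₁ n, lucasV P₂ Q₂ m,
    by rw [hn, lucasV_sq], by rw [hm, lucasV_sq]⟩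

theorem lucasU_three_one (n : ℕ) : lucasU 3 1 n = lucasU 1 (-1) (2 * n) := by
  suffices h : lucasU 3 1 n = lucasU 1 (-1) (2 * n) ∧
      lucasU 3 1 (n + 1) = lucasU 1 (-1) (2 * (n + 1)) from h.1
  induction n with
  | zero => simp [lucasU]
  | succ n ih =>
    refine ⟨ih.2, ?_⟩
    have h := ih.2
    simp only [Nat.mul_add, mul_one, lucasU, Nat.add_assoc, Nat.reduceAdd] at h ⊢
    rw [ih.1, h]
    ring

theorem strictMono_lucasU_three_one : StrictMono (lucasU 3 1) := by
  have h : ∀ n, 0 ≤ lucasU 3 1 n ∧ lucasU 3 1 n < lucasU 3 1 (n + 1) := by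
    intro n
    induction n with
    | zero => simp [lucasU]
    | succ n ih =>
      simp only [lucasU] at ih ⊢
      omega
  exact strictMono_nat_of_lt_succ fun n => (h n).2

theorem infinite_inter_lucasU : ({x : ℤ | ∃ n : ℕ, x = lucasU 1 (-1) n} ∩
    {x : ℤ | ∃ m : ℕ, x = lucasU 3 1 m}).Infinite := by
  refine (Set.infinite_range_of_injective strictMono_lucasU_three_one.injective).mono ?_
  rintro _ ⟨n, rfl⟩
  exact ⟨⟨2 * n, lucasU_three_one n⟩, n, rfl⟩

theorem eq_of_sq_sub_four_eq {P₁ P₂ : ℤ} (hP₁ : 0 < P₁) (hP₂ : 0 < P₂)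
    (h : P₁ ^ 2 - 4 * 1 = P₂ ^ 2 - 4 * (-1)) : P₁ = 3 ∧ P₂ = 1 := by
  have h1 : P₂ < P₁ := by nlinarith
  have h2 : P₁ + P₂ ≤ 8 := by nlinarith
  have h3 : P₁ < 8 := by omega
  have h4 : P₂ < 8 := by omega
  interval_cases P₁ <;> interval_cases P₂ <;> simp_all

theorem sq_sub_four_mul_eq_iff {P₁ Q₁ P₂ Q₂ : ℤ}
    (hP₁ : 0 < P₁) (hP₂ : 0 < P₂) (hQ₁ : |Q₁| = 1) (hQ₂ : |Q₂| = 1)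
    (hne : (P₁, Q₁) ≠ (P₂, Q₂)) :
    P₁ ^ 2 - 4 * Q₁ = P₂ ^ 2 - 4 * Q₂ ↔
      ((P₁, Q₁) = ((1 : ℤ), (-1 : ℤ)) ∧ (P₂, Q₂) = ((3 : ℤ), (1 : ℤ))) ∨
      ((P₁, Q₁) = ((3 : ℤ), (1 : ℤ)) ∧ (P₂, Q₂) = ((1 : ℤ), (-1 : ℤ))) := by
  constructor
  · intro h
    have hQ : Q₁ ≠ Q₂ := by
      rintro rfl
      refine hne (Prod.ext ?_ rfl)
      exact (pow_left_inj₀ hP₁.le hP₂.le two_ne_zero).1 (by linarith)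
    rcases (abs_eq zero_le_one).1 hQ₁ with rfl | rfl <;>
      rcases (abs_eq zero_le_one).1 hQ₂ with rfl | rfl
    · exact absurd rfl hQ
    · obtain ⟨rfl, rfl⟩ := eq_of_sq_sub_four_eq hP₁ hP₂ h
      simp
    · obtain ⟨rfl, rfl⟩ := eq_of_sq_sub_four_eq hP₂ hP₁ h.symm
      simp
    · exact absurd rfl hQ
  · simp only [Prod.mk.injEq]
    rintro (⟨⟨rfl, rfl⟩, rfl, rfl⟩ | ⟨⟨rfl, rfl⟩, rfl, rfl⟩) <;> norm_num

theorem UU_intersection_infinite_iff (P₁ Q₁ P₂ Q₂ : ℤ)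
    (hP₁ : 0 < P₁) (hP₂ : 0 < P₂) (hQ₁ : |Q₁| = 1) (hQ₂ : |Q₂| = 1)
    (hne : (P₁, Q₁) ≠ (P₂, Q₂))
    (hnd₁ : (P₁, Q₁) ≠ (1, 1) ∧ (P₁, Q₁) ≠ (2, 1))
    (hnd₂ : (P₂, Q₂) ≠ (1, 1) ∧ (P₂, Q₂) ≠ (2, 1)) :
    (({x : ℤ | ∃ n : ℕ, x = lucasU P₁ Q₁ n} ∩
        {x : ℤ | ∃ m : ℕ, x = lucasU P₂ Q₂ m}).Infinite ↔
      P₁ ^ 2 - 4 * Q₁ = P₂ ^ 2 - 4 * Q₂) ∧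
    (P₁ ^ 2 - 4 * Q₁ = P₂ ^ 2 - 4 * Q₂ ↔
      ((P₁, Q₁) = ((1 : ℤ), (-1 : ℤ)) ∧ (P₂, Q₂) = ((3 : ℤ), (1 : ℤ))) ∨
      ((P₁, Q₁) = ((3 : ℤ), (1 : ℤ)) ∧ (P₂, Q₂) = ((1 : ℤ), (-1 : ℤ)))) := by
  have hiff := sq_sub_four_mul_eq_iff hP₁ hP₂ hQ₁ hQ₂ hne
  refine ⟨⟨fun hinf => ?_, fun h => ?_⟩, hiff⟩
  · by_contra hD
    exact hinf (finite_inter_lucasU hP₁ hP₂ hQ₁ hQ₂ hnd₁ hnd₂ hD)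
  · rcases hiff.1 h with ⟨h₁, h₂⟩ | ⟨h₁, h₂⟩ <;> cases h₁ <;> cases h₂
    · exact infinite_inter_lucasU
    · rw [Set.inter_comm]
      exact infinite_inter_lucasU
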